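/- arXiv:1305.1709 — 2 statements merged into one kernel-verified Lean document; each statement's English description precedes it below -/
import Mathlib

section
/- Let (R,m,k) be a regular local ring, let I be an ideal of height d such that R/I satisfies Serre's condition S_2, and let z_1,…,z_d ∈ I be an R-regular sequence. Set Ω̃ = ((z_1,…,z_d) :_R I). Then Ext^d_R(R/Ω̃, R) ≅ I/(z_1,…,z_d) and Ext^{d+1}_R(R/Ω̃, R) = 0. -/
open IsLocalRing

universe u

variable (R : Type u) [CommRing R]

/-- `R` is a regular local ring: a Noetherian local ring whose maximal ideal is
generated by `dim R` elements. -/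
def IsRegularLocal [IsLocalRing R] : Prop :=
  IsNoetherianRing R ∧ ∃ (n : ℕ) (x : Fin n → R),
    Ideal.span (Set.range x) = maximalIdeal R ∧ ringKrullDim R = n

/-- The ideal `I` has height `d`: `d` is the minimum of the heights of the primes
containing `I`, the height of a prime `P` being `dim R_P`. -/
def HeightEq (I : Ideal R) (d : ℕ) : Prop :=
  (∃ (P : Ideal R) (h : P.IsPrime), I ≤ P ∧
      ringKrullDim (@Localization.AtPrime R _ P h) = d) ∧
    ∀ (P : Ideal R) (h : P.IsPrime), I ≤ P →
      (d : WithBot ℕ∞) ≤ ringKrullDim (@Localization.AtPrime R _ P h)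

/-- Serre's condition `S_n` for the ring `A`: for every prime `P` of `A`,
`depth A_P ≥ min(n, dim A_P)`, expressed by the existence of regular sequences
in the maximal ideal of `A_P` of every length `j ≤ min(n, dim A_P)`. -/
def SerreS (A : Type u) [CommRing A] (n : ℕ) : Prop :=
  ∀ (P : Ideal A) (h : P.IsPrime) (j : ℕ), j ≤ n →
    (j : WithBot ℕ∞) ≤ ringKrullDim (@Localization.AtPrime A _ P h) →
      ∃ rs : List (@Localization.AtPrime A _ P h), rs.length = j ∧
        (∀ r ∈ rs, r ∈ maximalIdeal (@Localization.AtPrime A _ P h)) ∧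
        RingTheory.Sequence.IsWeaklyRegular (@Localization.AtPrime A _ P h) rs

/-- The `R`-module `Ext_R^n(M, N)`. -/
noncomputable abbrev ExtMod (n : ℕ) (M N : Type u) [AddCommGroup M] [Module R M]
    [AddCommGroup N] [Module R N] : Type u :=
  ((Ext R (ModuleCat.{u} R) n).obj (Opposite.op (ModuleCat.of R M))).obj
    (ModuleCat.of R N)

section

open RingTheory.Sequence
open scoped Pointwise

theorem span_singleton_eq_smul_top {R : Type u} [CommRing R] (x : R) :
    x • (⊤ : Ideal R) = Ideal.span {x} := by
  simp [← Submodule.ideal_span_singleton_smul]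

/-- Killing an element of `𝔪 \ 𝔪²` lowers the number of generators of `𝔪`. -/
theorem exists_generators_quotient {R : Type u} [CommRing R] [IsLocalRing R] {n : ℕ}
    (x : Fin (n + 1) → R) (hx : Ideal.span (Set.range x) = maximalIdeal R) {y : R}
    (hy : y ∈ maximalIdeal R) (hy2 : y ∉ maximalIdeal R ^ 2) [IsLocalRing (R ⧸ Ideal.span {y})] :
    ∃ x' : Fin n → R ⧸ Ideal.span {y},
      Ideal.span (Set.range x') = maximalIdeal (R ⧸ Ideal.span {y}) := by
  obtain ⟨c, hc⟩ := Ideal.mem_span_range_iff_exists_fun.mp (hx ▸ hy)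
  have hxm (i : Fin (n + 1)) : x i ∈ maximalIdeal R := hx ▸ Ideal.subset_span ⟨i, rfl⟩
  obtain ⟨i, hi⟩ : ∃ i, IsUnit (c i) := by
    by_contra! h
    refine hy2 (hc ▸ Ideal.sum_mem _ fun i _ ↦ ?_)
    rw [pow_two]
    exact Ideal.mul_mem_mul ((mem_maximalIdeal _).mpr (h i)) (hxm i)
  have hmap : (maximalIdeal R).map (Ideal.Quotient.mk (Ideal.span {y})) =
      maximalIdeal (R ⧸ Ideal.span {y}) := by
    refine le_antisymm ?_ fun a ha ↦ ?_
    · refine ((local_hom_TFAE (Ideal.Quotient.mk (Ideal.span {y}))).out 0 2).mp ?_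
      exact .of_surjective _ Ideal.Quotient.mk_surjective
    · obtain ⟨a, rfl⟩ := Ideal.Quotient.mk_surjective a
      refine Ideal.mem_map_of_mem _ ?_
      rw [mem_maximalIdeal, mem_nonunits_iff] at ha ⊢
      exact fun h ↦ ha (h.map _)
  refine ⟨fun j ↦ Ideal.Quotient.mk _ (x (i.succAbove j)), ?_⟩
  rw [← hmap]
  apply le_antisymm
  · rw [Ideal.span_le]
    rintro _ ⟨j, rfl⟩
    exact Ideal.mem_map_of_mem _ (hxm _)
  · rw [← hx, Ideal.map_span, Ideal.span_le]
    rintro _ ⟨_, ⟨j, rfl⟩, rfl⟩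
    rcases Fin.eq_self_or_eq_succAbove i j with rfl | ⟨k, rfl⟩
    · have h0 : Ideal.Quotient.mk (Ideal.span {y}) (∑ i, c i * x i) = 0 := by
        rw [hc]
        exact Ideal.Quotient.eq_zero_iff_mem.mpr (Ideal.mem_span_singleton_self y)
      rw [Fin.sum_univ_succAbove _ j, map_add, map_mul, map_sum] at h0
      have hu := hi.map (Ideal.Quotient.mk (Ideal.span {y}))
      rw [SetLike.mem_coe, ← Ideal.unit_mul_mem_iff_mem _ hu, eq_neg_of_add_eq_zero_left h0]
      refine neg_mem (Ideal.sum_mem _ fun k _ ↦ ?_)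
      rw [map_mul]
      exact Ideal.mul_mem_left _ _ (Ideal.subset_span ⟨k, rfl⟩)
    · exact Ideal.subset_span ⟨k, rfl⟩

/-- A local ring with a nonminimal principal prime is a domain. -/
theorem isDomain_of_isPrime_span_singleton {R : Type u} [CommRing R] [IsLocalRing R]
    [IsNoetherianRing R] {y : R} (hy : y ∈ maximalIdeal R) [hp : (Ideal.span {y}).IsPrime]
    (hmin : ∀ q ∈ minimalPrimes R, y ∉ q) : IsDomain R := by
  obtain ⟨q, hq, hqle⟩ := Ideal.exists_minimalPrimes_le (I := ⊥) (J := Ideal.span {y}) bot_le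
  have hqp : q.IsPrime := hq.1.1
  have hyq := hmin q hq
  have hle : q ≤ maximalIdeal R • q := by
    intro a ha
    obtain ⟨b, rfl⟩ := Ideal.mem_span_singleton'.mp (hqle ha)
    rw [mul_comm]
    exact Submodule.smul_mem_smul hy ((hqp.mem_or_mem ha).resolve_right hyq)
  have hbot : q = ⊥ := Submodule.eq_bot_of_le_smul_of_le_jacobson_bot _ _
    (IsNoetherian.noetherian q) hle (IsLocalRing.jacobson_eq_maximalIdeal ⊥ bot_ne_top).ge
  have : (⊥ : Ideal R).IsPrime := hbot ▸ hqp
  exact IsDomain.of_bot_isPrime R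

/-- The maximal ideal of a regular local ring is generated by a regular sequence. -/
theorem isDomain_and_exists_isWeaklyRegular (n : ℕ) :
    ∀ (R : Type u) [CommRing R] [IsLocalRing R] [IsNoetherianRing R] (x : Fin n → R),
      Ideal.span (Set.range x) = maximalIdeal R → ringKrullDim R = n →
      IsDomain R ∧ ∃ rs : List R, rs.length = n ∧ IsWeaklyRegular R rs ∧
        Ideal.ofList rs = maximalIdeal R := by
  induction n with
  | zero =>
    intro R _ _ _ x hx _
    have hm : maximalIdeal R = ⊥ := by rw [← hx]; simp
    have : (⊥ : Ideal R).IsPrime := hm ▸ inferInstance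
    refine ⟨IsDomain.of_bot_isPrime R, [], rfl, .nil R R, ?_⟩
    simp [hm]
  | succ n ih =>
    intro R _ _ _ x hx hdim
    have hheight : (maximalIdeal R).height = (n + 1 : ℕ) := by
      have := maximalIdeal_height_eq_ringKrullDim (R := R)
      rw [hdim] at this
      exact_mod_cast this
    have hmin : ∀ q ∈ minimalPrimes R, ¬ maximalIdeal R ≤ q := by
      intro q hq hle
      have := hq.1.1
      have h0 := Ideal.height_eq_zero_iff.mpr hq
      rw [← IsLocalRing.eq_maximalIdeal (I := q) ?_] at hheight
      · rw [h0] at hheight; exact absurd hheight.symm (by exact_mod_cast Nat.succ_ne_zero n)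
      · rw [le_antisymm (le_maximalIdeal this.ne_top) hle]; infer_instance
    have hsq : ¬ maximalIdeal R ≤ maximalIdeal R ^ 2 := by
      intro hle
      rw [pow_two, ← smul_eq_mul] at hle
      have h0 : maximalIdeal R = ⊥ := Submodule.eq_bot_of_le_smul_of_le_jacobson_bot _ _
        (IsNoetherian.noetherian _) hle (IsLocalRing.jacobson_eq_maximalIdeal ⊥ bot_ne_top).ge
      rw [h0, Ideal.height_bot] at hheight
      exact absurd hheight (by exact_mod_cast (Nat.succ_ne_zero n).symm)
    have hfin := minimalPrimes.finite_of_isNoetherianRing R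
    obtain ⟨y, hym, hy⟩ : ∃ y ∈ maximalIdeal R,
        y ∉ maximalIdeal R ^ 2 ∧ ∀ q ∈ minimalPrimes R, y ∉ q := by
      by_contra! h
      have hsub : (maximalIdeal R : Set R) ⊆
          ⋃ i ∈ ((insert (maximalIdeal R ^ 2) hfin.toFinset : Finset (Ideal R)) : Set (Ideal R)),
            ((id i : Ideal R) : Set R) := by
        intro y hy
        simp only [Finset.coe_insert, Set.mem_iUnion]
        by_cases h2 : y ∈ maximalIdeal R ^ 2
        · exact ⟨_, Set.mem_insert _ _, h2⟩
        · obtain ⟨q, hq, hyq⟩ := h y hy h2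
          exact ⟨q, Set.mem_insert_of_mem _ (by simpa using! hq), hyq⟩
      obtain ⟨i, hi, hle⟩ := (Ideal.subset_union_prime (maximalIdeal R ^ 2) (maximalIdeal R ^ 2)
        (fun i hi h1 _ ↦ by
          rcases Finset.mem_insert.mp hi with rfl | hi
          · exact absurd rfl h1
          · exact ((Set.Finite.mem_toFinset hfin).mp hi).1.1)).mp hsub
      rcases Finset.mem_insert.mp hi with rfl | hi
      · exact hsq hle
      · exact hmin i ((Set.Finite.mem_toFinset hfin).mp hi) hle
    have hne : Ideal.span {y} ≠ ⊤ := by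
      rw [Ne, Ideal.span_singleton_eq_top]; exact (mem_maximalIdeal y).mp hym
    have : Nontrivial (R ⧸ Ideal.span {y}) := Ideal.Quotient.nontrivial_iff.mpr hne
    have : IsLocalRing (R ⧸ Ideal.span {y}) := .of_surjective' _ Ideal.Quotient.mk_surjective
    obtain ⟨x', hx'⟩ := exists_generators_quotient x hx hym hy.1
    have hdim' : ringKrullDim (R ⧸ Ideal.span {y}) = n := by
      have h := Module.supportDim_quotSMulTop_succ_eq_of_notMem_minimalPrimes_of_mem_maximalIdeal
        (M := R) (x := y) (by
          have : Module.annihilator R R = ⊥ := Module.annihilator_eq_bot.mpr inferInstance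
          rw [this]; exact hy.2) hym
      rw [Module.supportDim_quotient_eq_ringKrullDim, Module.supportDim_self_eq_ringKrullDim,
        ringKrullDim_eq_of_ringEquiv
          (Ideal.quotientEquivAlgOfEq R (span_singleton_eq_smul_top y)).toRingEquiv, hdim] at h
      have h1 : ringKrullDim (R ⧸ Ideal.span {y}) + (1 : ℕ) = (n : WithBot ℕ∞) + (1 : ℕ) := by
        push_cast at h ⊢; exact h
      exact ENat.WithBot.add_natCast_cancel.mp h1
    obtain ⟨hdom, rs, hlen, hreg, hspan⟩ := ih (R ⧸ Ideal.span {y}) x' hx' hdim'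
    have hprime : (Ideal.span {y}).IsPrime := (Ideal.Quotient.isDomain_iff_prime _).mp hdom
    refine ⟨isDomain_of_isPrime_span_singleton hym hy.2, ?_⟩
    obtain ⟨ts, rfl⟩ := List.map_surjective_iff.mpr Ideal.Quotient.mk_surjective rs
    refine ⟨y :: ts, by simpa using hlen, .cons ?_ ?_, ?_⟩
    · have := isDomain_of_isPrime_span_singleton hym hy.2
      refine IsSMulRegular.of_ne_zero ?_
      rintro rfl
      exact hy.1 (zero_mem _)
    · have := (isWeaklyRegular_map_algebraMap_iff (R ⧸ Ideal.span {y})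
        (R ⧸ Ideal.span {y}) ts).mp hreg
      exact ((Submodule.quotEquivOfEq _ _
        (span_singleton_eq_smul_top y)).isWeaklyRegular_congr ts).mpr this
    · rw [← Ideal.map_ofList] at hspan
      rw [Ideal.ofList_cons, sup_comm, ← Ideal.mk_ker (I := Ideal.span {y}),
        ← Ideal.comap_map_of_surjective' _ Ideal.Quotient.mk_surjective, hspan]
      exact ((local_hom_TFAE (Ideal.Quotient.mk (Ideal.span {y}))).out 0 4).mp
        (IsLocalHom.of_surjective (Ideal.Quotient.mk (Ideal.span {y})) Ideal.Quotient.mk_surjective)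

/-- Nakayama's lemma at a prime: if every element becomes divisible by `x ∈ p` after
multiplication by an element outside `p`, the module vanishes at `p`. -/
theorem exists_smul_eq_zero_of_forall_smul_eq {R : Type*} [CommRing R] {E : Type*}
    [AddCommGroup E] [Module R E] [Module.Finite R E] (p : Ideal R) [hp : p.IsPrime]
    {x : R} (hx : x ∈ p) (h : ∀ e : E, ∃ s ∉ p, ∃ e' : E, s • e = x • e') :
    ∃ s ∉ p, ∀ e : E, s • e = 0 := by
  classical
  obtain ⟨S, hS⟩ := Module.Finite.fg_top (R := R) (M := E)
  choose s hs e' he' using h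
  set t := ∏ e ∈ S, s e with ht
  have htp : t ∉ p := fun hmem ↦ by
    obtain ⟨e, _, he⟩ := hp.prod_mem_iff.mp hmem
    exact hs e he
  have hrange : LinearMap.range (LinearMap.lsmul R E t) ≤ Ideal.span {x} • ⊤ := by
    rw [LinearMap.range_eq_map, ← hS, Submodule.map_span_le]
    intro e he
    rw [hS, Submodule.ideal_span_singleton_smul, LinearMap.lsmul_apply, ht,
      ← Finset.prod_erase_mul _ _ he, mul_smul, he']
    exact Submodule.smul_mem _ _ (Submodule.smul_mem_pointwise_smul _ _ _ trivial)
  obtain ⟨P, hP, -, hc, hev⟩ :=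
    LinearMap.exists_monic_and_natDegree_eq_and_coeff_mem_pow_and_aeval_eq_zero R _ _ hrange
  refine ⟨P.eval t, fun hmem ↦ htp (hp.mem_of_pow_mem P.natDegree ?_), fun e ↦ ?_⟩
  · rw [Polynomial.eval_eq_sum_range, Finset.sum_range_succ, hP.coeff_natDegree, one_mul] at hmem
    refine (Ideal.add_mem_iff_right _ (Ideal.sum_mem _ fun i hi ↦ ?_)).mp hmem
    refine Ideal.mul_mem_right _ _ ?_
    have h1 := hc i
    have h2 : P.natDegree - i ≠ 0 := by have := Finset.mem_range.mp hi; omega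
    exact (Ideal.span_singleton_le_iff_mem p).mpr hx (Ideal.pow_le_self h2 h1)
  · have h3 : Polynomial.aeval (LinearMap.lsmul R E t) P = LinearMap.lsmul R E (P.eval t) := by
      have := Polynomial.aeval_algebraMap_apply (Module.End R E) t P
      rw [Polynomial.coe_aeval_eq_eval] at this
      exact this
    rw [h3] at hev
    exact congrArg (· e) hev

/-- An element whose annihilator is contained in a prime `p` gives rise to an associated prime
contained in `p`. -/
theorem exists_mem_associatedPrimes_le {R : Type*} [CommRing R] [IsNoetherianRing R] {M : Type*}
    [AddCommGroup M] [Module R M] (p : Ideal R) [hp : p.IsPrime] (m : M)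
    (hm : ∀ s : R, s • m = 0 → s ∈ p) :
    ∃ q ∈ associatedPrimes R M, (∀ s : R, s • m = 0 → s ∈ q) ∧ q ≤ p := by
  let N := LinearMap.range (LinearMap.toSpanSingleton R M m)
  have hann : Module.annihilator R N = LinearMap.ker (LinearMap.toSpanSingleton R M m) := by
    ext r
    simp only [Module.mem_annihilator, LinearMap.mem_ker, LinearMap.toSpanSingleton_apply]
    refine ⟨fun h ↦ congrArg Subtype.val (h ⟨m, 1, by simp⟩), ?_⟩
    rintro h ⟨_, a, rfl⟩
    ext
    simp [smul_comm r a, h]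
  obtain ⟨q, hq, hqp⟩ := Ideal.exists_minimalPrimes_le (I := Module.annihilator R N) (J := p)
    (fun s hs ↦ hm s (by rw [hann] at hs; simpa using hs))
  refine ⟨q, ?_, fun s hs ↦ hq.1.2 (by rw [hann]; simpa using hs), hqp⟩
  exact associatedPrimes.subset_of_injective (f := N.subtype) N.injective_subtype
    (Module.associatedPrimes.minimalPrimes_annihilator_subset_associatedPrimes R N hq)

theorem le_of_mem_associatedPrimes_of_forall_smul_eq_zero {R : Type*} [CommRing R]
    [IsNoetherianRing R] {M : Type*} [AddCommGroup M] [Module R M] {q : Ideal R}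
    (hq : q ∈ associatedPrimes R M) {a : R} (ha : ∀ m : M, a • m = 0) : a ∈ q := by
  obtain ⟨-, m, rfl⟩ := isAssociatedPrime_iff.mp hq
  exact Submodule.mem_colon_singleton.mpr (ha m)

theorem notMem_of_mem_associatedPrimes_of_isSMulRegular {R : Type*} [CommRing R]
    [IsNoetherianRing R] {M : Type*} [AddCommGroup M] [Module R M] {q : Ideal R}
    (hq : q ∈ associatedPrimes R M) {a : R} (ha : IsSMulRegular M a) : a ∉ q := by
  obtain ⟨hp, m, rfl⟩ := isAssociatedPrime_iff.mp hq
  intro h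
  have : m = 0 := ha (by simpa using Submodule.mem_colon_singleton.mp h)
  exact hp.ne_top (by simp [this, Ideal.eq_top_iff_one, Submodule.mem_colon_singleton])

/-- Associated primes grow when passing to the quotient by a regular element. -/
theorem exists_lt_mem_associatedPrimes_quotSMulTop {R : Type*} [CommRing R] [IsNoetherianRing R]
    {M : Type*} [AddCommGroup M] [Module R M] [Module.Finite R M] (p : Ideal R) [hp : p.IsPrime]
    {x : R} (hxp : x ∈ p) (hx : IsSMulRegular M x) {q : Ideal R}
    (hq : q ∈ associatedPrimes R M) (hqp : q ≤ p) :
    ∃ q' ∈ associatedPrimes R (QuotSMulTop x M), q < q' ∧ q' ≤ p := by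
  have hxq := notMem_of_mem_associatedPrimes_of_isSMulRegular hq hx
  obtain ⟨hqprime, m₀, hm₀⟩ := isAssociatedPrime_iff.mp hq
  let N : Submodule R M :=
    { carrier := {m | ∀ r ∈ q, r • m = 0}
      add_mem' := fun ha hb r hr ↦ by simp [ha r hr, hb r hr]
      zero_mem' := fun r hr ↦ by simp
      smul_mem' := fun c m hm r hr ↦ by rw [smul_comm, hm r hr, smul_zero] }
  have hm₀N : m₀ ∈ N := fun r hr ↦ by
    rw [hm₀] at hr; simpa using Submodule.mem_colon_singleton.mp hr
  obtain ⟨m, hm⟩ : ∃ m : N, ∀ s ∉ p, ∀ m' : N, s • m ≠ x • m' := by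
    by_contra! h
    obtain ⟨s, hs, h0⟩ := exists_smul_eq_zero_of_forall_smul_eq p hxp h
    refine hs (hqp ?_)
    rw [hm₀, Submodule.mem_colon_singleton]
    simpa using congrArg Subtype.val (h0 ⟨m₀, hm₀N⟩)
  have hkill : ∀ s : R, s • (Submodule.Quotient.mk (m : M) : QuotSMulTop x M) = 0 → s ∈ p := by
    intro s hs
    by_contra hsp
    rw [← Submodule.Quotient.mk_smul, Submodule.Quotient.mk_eq_zero,
      Submodule.mem_smul_pointwise_iff_exists] at hs
    obtain ⟨m', -, hm'⟩ := hs
    refine hm s hsp ⟨m', fun r hr ↦ hx ?_⟩ (Subtype.ext (by simpa using hm'.symm))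
    change x • r • m' = x • 0
    rw [smul_comm, hm', smul_comm, m.2 r hr]
    simp
  obtain ⟨q', hq', h1, h2⟩ := exists_mem_associatedPrimes_le p _ hkill
  refine ⟨q', hq', lt_of_le_of_ne (fun r hr ↦ h1 r ?_) ?_, h2⟩
  · rw [← Submodule.Quotient.mk_smul, m.2 r hr]
    rfl
  · rintro rfl
    refine hxq (h1 x ?_)
    rw [← Submodule.Quotient.mk_smul, Submodule.Quotient.mk_eq_zero]
    exact Submodule.smul_mem_pointwise_smul _ _ _ trivial

theorem height_add_length_le_of_isWeaklyRegular {R : Type*} [CommRing R] [IsNoetherianRing R]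
    (p : Ideal R) [hp : p.IsPrime] (rs : List R) :
    ∀ {M : Type*} [AddCommGroup M] [Module R M] [Module.Finite R M]
      (_ : IsWeaklyRegular M rs) (_ : ∀ r ∈ rs, r ∈ p) {q : Ideal R}
      (_ : q ∈ associatedPrimes R M) (_ : q ≤ p), q.height + rs.length ≤ p.height := by
  induction rs with
  | nil => intro M _ _ _ _ _ q _ hqp; simpa using Ideal.height_mono hqp
  | cons x rs ih =>
    intro M _ _ _ hreg hmem q hq hqp
    rw [isWeaklyRegular_cons_iff] at hreg
    obtain ⟨q', hq', hlt, hle⟩ := exists_lt_mem_associatedPrimes_quotSMulTop p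
      (hmem x (by simp)) hreg.1 hq hqp
    have h1 := ih hreg.2 (fun r hr ↦ hmem r (by simp [hr])) hq' hle
    have := hq.isPrime
    have := hq'.isPrime
    refine le_trans ?_ h1
    rw [List.length_cons, Nat.cast_add, Nat.cast_one, add_comm (rs.length : ℕ∞), ← add_assoc]
    gcongr
    exact Ideal.height_add_one_le_of_lt_of_isPrime hlt

theorem exists_isPrime_between_of_isWeaklyRegular {R : Type*} [CommRing R] [IsNoetherianRing R]
    {M : Type*} [AddCommGroup M] [Module R M] [Module.Finite R M] (p : Ideal R) [hp : p.IsPrime]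
    {x y : R} {rs : List R} (hreg : IsWeaklyRegular M (x :: y :: rs)) (hx : x ∈ p) (hy : y ∈ p)
    {q : Ideal R} (hq : q ∈ associatedPrimes R M) (hqp : q ≤ p) :
    ∃ q₁ : Ideal R, q₁.IsPrime ∧ q < q₁ ∧ q₁ < p := by
  rw [isWeaklyRegular_cons_iff, isWeaklyRegular_cons_iff] at hreg
  obtain ⟨q₁, hq₁, h1, h2⟩ := exists_lt_mem_associatedPrimes_quotSMulTop p hx hreg.1 hq hqp
  obtain ⟨q₂, hq₂, h3, h4⟩ := exists_lt_mem_associatedPrimes_quotSMulTop p hy hreg.2.1 hq₁ h2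
  exact ⟨q₁, hq₁.isPrime, h1, h3.trans_le h4⟩

open CategoryTheory Abelian in
theorem height_add_le_of_subsingleton_ext {R : Type u} [CommRing R] [IsLocalRing R]
    [IsNoetherianRing R] (rs : List R) :
    ∀ {M : Type u} [AddCommGroup M] [Module R M] [Module.Finite R M] {n : ℕ}
      (_ : ∀ i < n, Subsingleton (Ext (ModuleCat.of R (R ⧸ maximalIdeal R)) (ModuleCat.of R M) i))
      (_ : IsWeaklyRegular M rs) {q : Ideal R}
      (_ : q ∈ associatedPrimes R (M ⧸ Ideal.ofList rs • (⊤ : Submodule R M))),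
      q.height + n ≤ (maximalIdeal R).height + rs.length := by
  induction rs with
  | nil =>
    intro M _ _ _ n hext _ q hq
    have e : (M ⧸ Ideal.ofList ([] : List R) • (⊤ : Submodule R M)) ≃ₗ[R] M :=
      Submodule.quotEquivOfEqBot _ (by simp)
    rw [LinearEquiv.AssociatedPrimes.eq e] at hq
    have hM : Nontrivial M := by
      by_contra h
      rw [not_nontrivial_iff_subsingleton] at h
      exact not_isAssociatedPrime_of_subsingleton hq
    obtain ⟨xs, hlen, hmem, hxs⟩ := ModuleCat.exists_isRegular_of_exists_subsingleton_ext
      (maximalIdeal R) n (ModuleCat.of R M)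
      (Submodule.top_ne_ideal_smul_of_le_jacobson_annihilator
        (IsLocalRing.maximalIdeal_le_jacobson _)).symm.lt_top
      (ModuleCat.of R (R ⧸ maximalIdeal R))
      (by rw [Module.support_eq_zeroLocus]; simp [Ideal.annihilator_quotient]) hext
    have := height_add_length_le_of_isWeaklyRegular (maximalIdeal R) xs hxs.toIsWeaklyRegular
      hmem hq (IsLocalRing.le_maximalIdeal hq.isPrime.ne_top)
    simpa [hlen] using this
  | cons x rs ih =>
    intro M _ _ _ n hext hreg q hq
    rw [isWeaklyRegular_cons_iff] at hreg
    rw [LinearEquiv.AssociatedPrimes.eq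
      (Submodule.quotOfListConsSMulTopEquivQuotSMulTopInner M x rs)] at hq
    have hext' : ∀ i < n - 1, Subsingleton (Ext (ModuleCat.of R (R ⧸ maximalIdeal R))
        (ModuleCat.of R (QuotSMulTop x M)) i) := by
      intro i hi
      have zero1 := AddCommGrpCat.isZero_of_iff_subsingleton.mpr (hext i (by omega))
      have zero2 := AddCommGrpCat.isZero_of_iff_subsingleton.mpr (hext (i + 1) (by omega))
      have hreg1 : IsSMulRegular (ModuleCat.of R M) x := hreg.1
      exact AddCommGrpCat.subsingleton_of_isZero <| ShortComplex.Exact.isZero_of_both_zeros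
        ((Ext.covariant_sequence_exact₃' _ hreg1.smulShortComplex_shortExact) i (i + 1) rfl)
        (zero1.eq_zero_of_src _) (zero2.eq_zero_of_tgt _)
    have h1 := ih hext' hreg.2 hq
    calc q.height + n ≤ q.height + ((n - 1 : ℕ) + 1) := by
          gcongr; norm_cast; omega
      _ ≤ _ := by rw [← add_assoc, List.length_cons, Nat.cast_add, ← add_assoc]; gcongr; simp

/-- A list of elements of a local ring `R` exhibiting `R` as a regular local ring. -/
structure IsRegularSystem {R : Type u} [CommRing R] [IsLocalRing R] (xs : List R) : Prop where
  isWeaklyRegular : IsWeaklyRegular R xs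
  ofList_eq : Ideal.ofList xs = maximalIdeal R
  height_eq : (maximalIdeal R).height = xs.length

namespace IsRegularSystem

variable {R : Type u} [CommRing R] [IsLocalRing R] [IsNoetherianRing R] {xs : List R}

theorem height_le_length (h : IsRegularSystem xs) {rs : List R} (hrs : IsWeaklyRegular R rs)
    {q : Ideal R} (hq : q ∈ associatedPrimes R (R ⧸ Ideal.ofList rs)) :
    q.height ≤ rs.length := by
  have h1 := ModuleCat.subsingleton_ext_of_exists_isRegular (maximalIdeal R)
    (ModuleCat.of R (R ⧸ maximalIdeal R))
    (by rw [Module.support_eq_zeroLocus]; simp [Ideal.annihilator_quotient])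
    (ModuleCat.of R R)
    (Submodule.top_ne_ideal_smul_of_le_jacobson_annihilator
        (IsLocalRing.maximalIdeal_le_jacobson _)).symm.lt_top xs
    (fun r hr ↦ h.ofList_eq ▸ Ideal.subset_span hr)
    (isRegular_iff _ _ |>.mpr ⟨h.isWeaklyRegular, by
      rw [h.ofList_eq]
      exact (Submodule.top_ne_ideal_smul_of_le_jacobson_annihilator
        (IsLocalRing.maximalIdeal_le_jacobson _))⟩)
  have e : (R ⧸ Ideal.ofList rs • (⊤ : Submodule R R)) ≃ₗ[R] R ⧸ Ideal.ofList rs :=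
    Submodule.quotEquivOfEq _ _ (by simp)
  have h2 := height_add_le_of_subsingleton_ext rs h1 hrs
    (by rwa [LinearEquiv.AssociatedPrimes.eq e])
  rw [h.height_eq, add_comm] at h2
  exact (ENat.add_le_add_iff_left (ENat.natCast_ne_top _)).mp h2

theorem length_le_height [IsDomain R] {rs : List R} (hrs : IsWeaklyRegular R rs)
    {p : Ideal R} [p.IsPrime] (hp : ∀ r ∈ rs, r ∈ p) : rs.length ≤ p.height := by
  refine le_trans le_add_self
    (height_add_length_le_of_isWeaklyRegular p rs hrs hp (q := ⊥) ?_ bot_le)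
  rw [associatedPrimes]
  refine isAssociatedPrime_iff.mpr ⟨Ideal.isPrime_bot, 1, ?_⟩
  ext; simp [Submodule.mem_colon_singleton]

theorem exists_append [IsDomain R] (h : IsRegularSystem xs) {p : Ideal R} [p.IsPrime]
    (rs : List R) (hrs : IsWeaklyRegular R rs) (hp : ∀ r ∈ rs, r ∈ p) :
    ∃ rs' : List R, IsWeaklyRegular R (rs ++ rs') ∧ (∀ r ∈ rs ++ rs', r ∈ p) ∧
      p.height = (rs ++ rs').length := by
  induction hk : xs.length - rs.length using Nat.strong_induction_on generalizing rs with
  | _ k ih =>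
  by_cases hx : ∃ x ∈ p, IsSMulRegular (R ⧸ Ideal.ofList rs • (⊤ : Submodule R R)) x
  · obtain ⟨x, hxp, hx⟩ := hx
    have hreg : IsWeaklyRegular R (rs ++ [x]) :=
      (isWeaklyRegular_append_iff _ _ _).mpr ⟨hrs, (isWeaklyRegular_singleton_iff _ _).mpr hx⟩
    have hmem : ∀ r ∈ rs ++ [x], r ∈ p := by
      intro r hr
      rcases List.mem_append.mp hr with hr | hr
      · exact hp r hr
      · rwa [List.mem_singleton.mp hr]
    have hlen : (rs ++ [x]).length ≤ xs.length := by
      have h1 := (length_le_height hreg hmem).trans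
        (Ideal.height_mono (IsLocalRing.le_maximalIdeal (Ideal.IsPrime.ne_top ‹_›)))
      rw [h.height_eq] at h1
      exact_mod_cast h1
    rw [List.length_append, List.length_singleton] at hlen
    obtain ⟨rs', h1, h2, h3⟩ := ih _ (by
      rw [← hk, List.length_append, List.length_singleton]; omega)
      (rs ++ [x]) hreg hmem rfl
    exact ⟨x :: rs', by simpa using h1, by simpa using h2, by simpa using h3⟩
  · refine ⟨[], by simpa using hrs, by simpa using hp, le_antisymm ?_ ?_⟩
    · push Not at hx
      have e : (R ⧸ Ideal.ofList rs • (⊤ : Submodule R R)) ≃ₗ[R] R ⧸ Ideal.ofList rs :=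
        Submodule.quotEquivOfEq _ _ (by simp)
      obtain ⟨q, hq, hpq⟩ := (Ideal.subset_union_prime_finite
        (associatedPrimes.finite R (R ⧸ Ideal.ofList rs)) (f := id) ⊥ ⊥
        (fun i hi _ _ ↦ IsAssociatedPrime.isPrime hi) (I := p)).mp (by
          intro x hxp
          have h1 := hx x hxp
          simp_rw [id, biUnion_associatedPrimes_eq_zero_divisors]
          rw [isSMulRegular_iff_right_eq_zero_of_smul] at h1
          push Not at h1
          obtain ⟨m, hm, hm0⟩ := h1
          exact ⟨e m, by simpa using hm0, by rw [← map_smul, hm, map_zero]⟩)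
      refine (Ideal.height_mono hpq).trans ?_
      simpa using h.height_le_length hrs hq
    · simpa using length_le_height hrs hp

theorem exists_isPrime_between [IsDomain R] (h : IsRegularSystem xs) {q p : Ideal R} [q.IsPrime]
    [p.IsPrime] (hqp : q ≤ p) (hht : q.height + 2 ≤ p.height) :
    ∃ q₁ : Ideal R, q₁.IsPrime ∧ q < q₁ ∧ q₁ < p := by
  obtain ⟨rs, hrs, hmem, hlen⟩ := h.exists_append (p := q) [] (by simp) (by simp)
  rw [List.nil_append] at hrs hmem hlen
  obtain ⟨rs', hrs', hmem', hlen'⟩ := h.exists_append (p := p) rs hrs fun r hr ↦ hqp (hmem r hr)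
  rw [hlen, hlen', List.length_append] at hht
  have h2 : 2 ≤ rs'.length := by
    have : rs.length + 2 ≤ rs.length + rs'.length := by exact_mod_cast hht
    omega
  match rs', h2 with
  | x :: y :: l, _ =>
  rw [isWeaklyRegular_append_iff] at hrs'
  have e : (R ⧸ Ideal.ofList rs • (⊤ : Submodule R R)) ≃ₗ[R] R ⧸ Ideal.ofList rs :=
    Submodule.quotEquivOfEq _ _ (by simp)
  have hle : Ideal.ofList rs ≤ q := Ideal.span_le.mpr hmem
  have hq : q ∈ associatedPrimes R (R ⧸ Ideal.ofList rs • (⊤ : Submodule R R)) := by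
    rw [LinearEquiv.AssociatedPrimes.eq e]
    apply Module.associatedPrimes.minimalPrimes_annihilator_subset_associatedPrimes
    rw [Ideal.annihilator_quotient]
    refine ⟨⟨‹_›, hle⟩, fun q' hq' hle' ↦ ?_⟩
    have := hq'.1
    by_contra hlt
    have h1 : q'.height < q.height :=
      Ideal.height_strict_mono_of_isPrime_of_isPrime (lt_of_le_not_ge hle' hlt)
    have h2 := length_le_height hrs (p := q') fun r hr ↦ hq'.2 (Ideal.subset_span hr)
    exact absurd (h1.trans_le (hlen.le.trans h2)) (lt_irrefl _)
  exact exists_isPrime_between_of_isWeaklyRegular p hrs'.2 (hmem' x (by simp))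
    (hmem' y (by simp)) hq hqp

end IsRegularSystem

section ExtModules

open CategoryTheory Abelian

variable {R : Type u} [CommRing R]

/-- `Ext` groups of modules, in unbundled form. -/
noncomputable abbrev ModuleExt (R : Type u) [CommRing R] (M N : Type u) [AddCommGroup M]
    [Module R M] [AddCommGroup N] [Module R N] (n : ℕ) : Type u :=
  Abelian.Ext (ModuleCat.of R M) (ModuleCat.of R N) n

namespace ModuleExt

variable {X X₁ X₂ X₃ Y : Type u} [AddCommGroup X] [Module R X] [AddCommGroup X₁] [Module R X₁]
  [AddCommGroup X₂] [Module R X₂] [AddCommGroup X₃] [Module R X₃] [AddCommGroup Y] [Module R Y]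

/-- Precomposition by a linear map on `Ext`. -/
noncomputable def precomp (f : X₁ →ₗ[R] X₂) (Y : Type u) [AddCommGroup Y] [Module R Y] (n : ℕ) :
    ModuleExt R X₂ Y n →ₗ[R] ModuleExt R X₁ Y n where
  toFun e := (Ext.mk₀ (ModuleCat.ofHom f)).comp e (zero_add n)
  map_add' := by simp
  map_smul' := by simp

theorem precomp_smul_id (r : R) (n : ℕ) (e : ModuleExt R X Y n) :
    precomp (r • LinearMap.id) Y n e = r • e := by
  have h : ModuleCat.ofHom (r • (LinearMap.id : X →ₗ[R] X)) = r • 𝟙 (ModuleCat.of R X) := rfl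
  simp [precomp, h, Ext.mk₀_smul]

theorem precomp_comp (f : X₁ →ₗ[R] X₂) (g : X₂ →ₗ[R] X₃) (n : ℕ) (e : ModuleExt R X₃ Y n) :
    precomp (g ∘ₗ f) Y n e = precomp f Y n (precomp g Y n e) := by
  simp [precomp, ModuleCat.ofHom_comp]

theorem smul_eq_zero_of_forall {z : R} (hz : ∀ x : X, z • x = 0) (n : ℕ) (e : ModuleExt R X Y n) :
    z • e = 0 := by
  have h : z • (LinearMap.id : X →ₗ[R] X) = 0 := by ext; simp [hz]
  rw [← precomp_smul_id, h]
  simp [precomp]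

/-- A short exact sequence of modules as a short complex. -/
def shortComplex (f : X₁ →ₗ[R] X₂) (g : X₂ →ₗ[R] X₃) (hfg : Function.Exact f g) :
    ShortComplex (ModuleCat.{u} R) :=
  ShortComplex.mk (ModuleCat.ofHom f) (ModuleCat.ofHom g) (by
    ext x; exact hfg.apply_apply_eq_zero x)

variable {f : X₁ →ₗ[R] X₂} {g : X₂ →ₗ[R] X₃} (hf : Function.Injective f) (hfg : Function.Exact f g)
  (hg : Function.Surjective g)

include hf hg in
theorem shortExact_shortComplex : (shortComplex f g hfg).ShortExact :=
  ModuleCat.shortComplex_shortExact _ hfg hf hg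

/-- The connecting map of the contravariant long exact sequence. -/
noncomputable def connecting (Y : Type u) [AddCommGroup Y] [Module R Y] (n : ℕ) :
    ModuleExt R X₁ Y n →ₗ[R] ModuleExt R X₃ Y (n + 1) where
  toFun e := (shortExact_shortComplex hf hfg hg).extClass.comp e (add_comm 1 n)
  map_add' := by intro a b; exact Ext.comp_add ..
  map_smul' := by intro r b; exact Ext.comp_smul ..

include hf hfg hg in
theorem exact_precomp_precomp (n : ℕ) :
    Function.Exact (precomp g Y n) (precomp f Y n) := by
  intro e
  refine ⟨fun h ↦ Ext.contravariant_sequence_exact₂ (shortExact_shortComplex hf hfg hg) _ e h, ?_⟩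
  rintro ⟨e, rfl⟩
  rw [← precomp_comp, hfg.linearMap_comp_eq_zero]
  simp [precomp]

theorem exact_precomp_connecting (n : ℕ) :
    Function.Exact (precomp f Y n) (connecting hf hfg hg Y n) := by
  intro e
  refine ⟨fun h ↦ Ext.contravariant_sequence_exact₁
    (shortExact_shortComplex hf hfg hg) _ e (add_comm 1 n) h, ?_⟩
  rintro ⟨e, rfl⟩
  exact (shortExact_shortComplex hf hfg hg).extClass_comp_assoc e (h := add_comm 1 n)

theorem exact_connecting_precomp (n : ℕ) :
    Function.Exact (connecting hf hfg hg Y n) (precomp g Y (n + 1)) := by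
  intro e
  refine ⟨fun h ↦ Ext.contravariant_sequence_exact₃
    (shortExact_shortComplex hf hfg hg) _ e h (add_comm 1 n), ?_⟩
  rintro ⟨e, rfl⟩
  exact (shortExact_shortComplex hf hfg hg).comp_extClass_assoc e (h := add_comm 1 n)

end ModuleExt

end ExtModules

/-- The localization at `p` of `Ext^j(M, R)` vanishes, in terms of a common annihilator. -/
def ExtVanishesAt {R : Type u} [CommRing R] (p : Ideal R) (M : Type u) [AddCommGroup M]
    [Module R M] (j : ℕ) : Prop :=
  ∃ s ∉ p, ∀ e : ModuleExt R M R j, s • e = 0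

namespace ExtVanishesAt

open ModuleExt

variable {R : Type u} [CommRing R] {p : Ideal R} {X₁ X₂ X₃ : Type u} [AddCommGroup X₁]
  [Module R X₁] [AddCommGroup X₂] [Module R X₂] [AddCommGroup X₃] [Module R X₃] {j : ℕ}
  {f : X₁ →ₗ[R] X₂} {g : X₂ →ₗ[R] X₃}

theorem mono {p' : Ideal R} (h : ExtVanishesAt p' X₁ j) (hp : p ≤ p') : ExtVanishesAt p X₁ j := by
  obtain ⟨s, hs, h⟩ := h
  exact ⟨s, fun hsp ↦ hs (hp hsp), h⟩

theorem of_smul_eq_zero {z : R} (hzp : z ∉ p) (hz : ∀ x : X₁, z • x = 0) : ExtVanishesAt p X₁ j :=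
  ⟨z, hzp, smul_eq_zero_of_forall hz j⟩

theorem of_exact [p.IsPrime] (hf : Function.Injective f) (hfg : Function.Exact f g)
    (hg : Function.Surjective g) (h₁ : ExtVanishesAt p X₁ j) (h₃ : ExtVanishesAt p X₃ j) :
    ExtVanishesAt p X₂ j := by
  obtain ⟨s, hs, h₁⟩ := h₁
  obtain ⟨t, ht, h₃⟩ := h₃
  refine ⟨t * s, fun hts ↦ (Ideal.IsPrime.mem_or_mem ‹_› hts).elim ht hs, fun e ↦ ?_⟩
  obtain ⟨e', he'⟩ := (exact_precomp_precomp hf hfg hg j (s • e)).mp (by rw [map_smul, h₁])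
  rw [mul_smul, ← he', ← map_smul, h₃, map_zero]

theorem of_exact_smul [IsNoetherianRing R] [Module.Finite R X₂] [p.IsPrime] {x : R} (hx : x ∈ p)
    {f : X₂ →ₗ[R] X₂} (hfx : ∀ m, f m = x • m)
    (hf : Function.Injective f) (hfg : Function.Exact f g)
    (hg : Function.Surjective g) (h : ExtVanishesAt p X₃ (j + 1)) : ExtVanishesAt p X₂ j := by
  obtain ⟨s, hs, h⟩ := h
  obtain rfl : f = x • LinearMap.id := by ext m; simp [hfx]
  refine exists_smul_eq_zero_of_forall_smul_eq p hx fun e ↦ ⟨s, hs, ?_⟩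
  obtain ⟨e', he'⟩ := (exact_precomp_connecting hf hfg hg j (s • e)).mp (by rw [map_smul, h])
  exact ⟨e', by rw [← he', precomp_smul_id]⟩

end ExtVanishesAt

/-- The short exact sequence `0 → R/(a : y) → R/a → R/(a + (y)) → 0`. -/
theorem exists_shortExact_colon {R : Type u} [CommRing R] (a b : Ideal R) (y : R)
    (hb : ∀ r, r ∈ b ↔ r * y ∈ a) :
    ∃ (f : (R ⧸ b) →ₗ[R] R ⧸ a) (g : (R ⧸ a) →ₗ[R] R ⧸ (a ⊔ Ideal.span {y})),
      (∀ r, f (Ideal.Quotient.mk b r) = Ideal.Quotient.mk a (r * y)) ∧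
      Function.Injective f ∧ Function.Exact f g ∧ Function.Surjective g := by
  have hker : LinearMap.ker (a.mkQ ∘ₗ LinearMap.toSpanSingleton R R y) = b := by
    ext r; simp [hb, Ideal.Quotient.eq_zero_iff_mem, -map_mul]
  refine ⟨Submodule.liftQ b (a.mkQ ∘ₗ LinearMap.toSpanSingleton R R y) hker.ge,
    Submodule.factor le_sup_left, fun r ↦ rfl, ?_, ?_, Submodule.factor_surjective _⟩
  · rw [← LinearMap.ker_eq_bot]
    exact Submodule.ker_liftQ_eq_bot' _ _ hker.symm
  · intro m
    obtain ⟨m, rfl⟩ := Ideal.Quotient.mk_surjective m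
    have h1 : (Submodule.factor (le_sup_left : a ≤ a ⊔ Ideal.span {y})) (Ideal.Quotient.mk a m) =
      Ideal.Quotient.mk (a ⊔ Ideal.span {y}) m := rfl
    rw [h1, Ideal.Quotient.eq_zero_iff_mem]
    constructor
    · intro hm
      obtain ⟨i, hi, z, hz, rfl⟩ := Submodule.mem_sup.mp hm
      obtain ⟨c, rfl⟩ := Ideal.mem_span_singleton'.mp hz
      refine ⟨Ideal.Quotient.mk b c, ?_⟩
      change Ideal.Quotient.mk a (c * y) = _
      rw [map_add, Ideal.Quotient.eq_zero_iff_mem.mpr hi, zero_add]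
    · rintro ⟨c, hc⟩
      obtain ⟨c, rfl⟩ := Ideal.Quotient.mk_surjective c
      change Ideal.Quotient.mk a (c * y) = _ at hc
      rw [Ideal.Quotient.eq] at hc
      have h2 : c * y ∈ a ⊔ Ideal.span {y} :=
        Submodule.mem_sup_right (Ideal.mul_mem_left _ _ (Ideal.mem_span_singleton_self y))
      have h3 := Ideal.sub_mem _ h2 (Submodule.mem_sup_left (T := Ideal.span {y}) hc)
      simpa using h3

theorem subsingleton_ext_quotSMulTop {R : Type u} [CommRing R] {M Y : Type u} [AddCommGroup M]
    [Module R M] [AddCommGroup Y] [Module R Y] {x : R} (hx : IsSMulRegular M x) {n : ℕ}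
    (h : ∀ j, n < j → Subsingleton (ModuleExt R M Y j)) {j : ℕ} (hj : n + 1 < j) :
    Subsingleton (ModuleExt R (QuotSMulTop x M) Y j) := by
  obtain ⟨j, rfl⟩ : ∃ i, j = i + 1 := ⟨j - 1, by omega⟩
  have := h j (by omega)
  have := h (j + 1) (by omega)
  have hinj : Function.Injective (LinearMap.lsmul R M x) := hx
  have hex : Function.Exact (LinearMap.lsmul R M x) (x • (⊤ : Submodule R M)).mkQ := by
    intro m
    rw [Submodule.mkQ_apply, Submodule.Quotient.mk_eq_zero,
      Submodule.mem_smul_pointwise_iff_exists]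
    simp
  refine subsingleton_of_forall_eq 0 fun e ↦ ?_
  obtain ⟨e', rfl⟩ := (ModuleExt.exact_connecting_precomp (Y := Y) hinj hex
    (Submodule.mkQ_surjective _) j e).mp (Subsingleton.elim _ _)
  rw [Subsingleton.elim e' 0, map_zero]

theorem ModuleExt.subsingleton_congr {R : Type u} [CommRing R] {M M' Y : Type u} [AddCommGroup M]
    [Module R M] [AddCommGroup M'] [Module R M'] [AddCommGroup Y] [Module R Y] (e : M ≃ₗ[R] M')
    (j : ℕ) (h : Subsingleton (ModuleExt R M' Y j)) : Subsingleton (ModuleExt R M Y j) := by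
  refine subsingleton_of_forall_eq 0 fun a ↦ ?_
  have h1 := precomp_comp (e : M →ₗ[R] M') (e.symm : M' →ₗ[R] M) j a
  have h2 := precomp_smul_id (X := M) (1 : R) j a
  rw [one_smul, one_smul] at h2
  rw [LinearEquiv.symm_comp, h2, Subsingleton.elim (precomp (e.symm : M' →ₗ[R] M) Y j a) 0,
    map_zero] at h1
  exact h1

theorem subsingleton_ext_quotient_ofList_smul_top {R : Type u} [CommRing R] {Y : Type u}
    [AddCommGroup Y] [Module R Y] (rs : List R) :
    ∀ {M : Type u} [AddCommGroup M] [Module R M] (_ : IsWeaklyRegular M rs) {n : ℕ}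
    (_ : ∀ j, n < j → Subsingleton (ModuleExt R M Y j)) {j : ℕ} (_ : n + rs.length < j),
    Subsingleton (ModuleExt R (M ⧸ Ideal.ofList rs • (⊤ : Submodule R M)) Y j) := by
  induction rs with
  | nil =>
    intro M _ _ _ n h j hj
    exact ModuleExt.subsingleton_congr (Submodule.quotEquivOfEqBot _ (by simp)) j
      (h j (by simpa using hj))
  | cons x rs ih =>
    intro M _ _ hreg n h j hj
    rw [isWeaklyRegular_cons_iff] at hreg
    refine ModuleExt.subsingleton_congr
      (Submodule.quotOfListConsSMulTopEquivQuotSMulTopInner M x rs) j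
      (ih hreg.2 (n := n + 1) (fun i hi ↦ subsingleton_ext_quotSMulTop hreg.1 h hi) ?_)
    rw [List.length_cons] at hj
    omega

theorem subsingleton_ext_quotient_ofList {R : Type u} [CommRing R] (Y : Type u)
    [AddCommGroup Y] [Module R Y] {rs : List R} (hrs : IsWeaklyRegular R rs) {j : ℕ}
    (hj : rs.length < j) : Subsingleton (ModuleExt R (R ⧸ Ideal.ofList rs) Y j) := by
  refine ModuleExt.subsingleton_congr
    (Submodule.quotEquivOfEq _ (Ideal.ofList rs • (⊤ : Submodule R R)) (by simp)) j
    (subsingleton_ext_quotient_ofList_smul_top rs hrs (n := 0) (fun i hi ↦ ?_) (by omega))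
  obtain ⟨i, rfl⟩ : ∃ k, i = k + 1 := ⟨i - 1, by omega⟩
  exact subsingleton_of_forall_eq 0 fun e ↦ CategoryTheory.Abelian.Ext.eq_zero_of_projective e

theorem IsRegularSystem.extVanishesAt_maximalIdeal {R : Type u} [CommRing R] [IsLocalRing R]
    [IsNoetherianRing R] {xs : List R} (h : IsRegularSystem xs) (a : Ideal R) :
    ∀ {j : ℕ} (_ : (maximalIdeal R).height < j), ExtVanishesAt (maximalIdeal R) (R ⧸ a) j := by
  have h1 : (1 : R) ∉ maximalIdeal R := fun h ↦ (maximalIdeal.isMaximal R).ne_top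
    ((Ideal.eq_top_iff_one _).mpr h)
  induction a using WellFoundedGT.induction with
  | ind a ih =>
  intro j hj
  by_cases htop : a = ⊤
  · have : Subsingleton (R ⧸ a) := Ideal.Quotient.subsingleton_iff.mpr htop
    exact .of_smul_eq_zero h1 fun _ ↦ Subsingleton.elim _ _
  have ham := IsLocalRing.le_maximalIdeal htop
  by_cases hm : a = maximalIdeal R
  · have := subsingleton_ext_quotient_ofList R h.isWeaklyRegular (j := j) (by
      rw [h.height_eq] at hj; exact_mod_cast hj)
    rw [h.ofList_eq, ← hm] at this
    exact ⟨1, h1, fun e ↦ Subsingleton.elim _ _⟩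
  by_cases ha : a.IsPrime
  · obtain ⟨x, hx, hxa⟩ := SetLike.exists_of_lt (lt_of_le_of_ne ham hm)
    obtain ⟨f, g, hfx, hf, hfg, hg⟩ := exists_shortExact_colon a a x
      fun r ↦ ⟨fun hr ↦ a.mul_mem_right _ hr, fun hr ↦ (ha.mem_or_mem hr).resolve_right hxa⟩
    refine ExtVanishesAt.of_exact_smul hx (f := f) (fun m ↦ ?_) hf hfg hg
      (ih _ ?_ (j := j + 1) (hj.trans (by norm_cast; omega)))
    · obtain ⟨m, rfl⟩ := Ideal.Quotient.mk_surjective m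
      rw [hfx, mul_comm]
      rfl
    · exact left_lt_sup.mpr fun h ↦ hxa (h (Ideal.mem_span_singleton_self x))
  · have : Nontrivial (R ⧸ a) := Ideal.Quotient.nontrivial_iff.mpr htop
    obtain ⟨q, hq⟩ := associatedPrimes.nonempty R (R ⧸ a)
    have hqp := hq.isPrime
    obtain ⟨-, y, hqy⟩ := isAssociatedPrime_iff.mp hq
    obtain ⟨y, rfl⟩ := Ideal.Quotient.mk_surjective y
    have hqy' : ∀ r, r ∈ q ↔ r * y ∈ a := by
      intro r
      rw [hqy, Submodule.mem_colon_singleton, Submodule.mem_bot, ← Ideal.Quotient.eq_zero_iff_mem]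
      rfl
    obtain ⟨f, g, hfx, hf, hfg, hg⟩ := exists_shortExact_colon a q y hqy'
    refine .of_exact hf hfg hg (ih q (lt_of_le_of_ne ?_ ?_) hj) (ih _ ?_ hj)
    · exact fun r hr ↦ (hqy' r).mpr (a.mul_mem_right _ hr)
    · rintro rfl; exact ha hqp
    · refine left_lt_sup.mpr fun h ↦ hqp.ne_top ((Ideal.eq_top_iff_one _).mpr ?_)
      rw [hqy', one_mul]
      exact h (Ideal.mem_span_singleton_self y)

/-- `Ext^j(R/a, R)` vanishes at every prime of height less than `j`. -/
theorem IsRegularSystem.extVanishesAt {R : Type u} [CommRing R] [IsLocalRing R] [IsDomain R]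
    [IsNoetherianRing R] {xs : List R} (h : IsRegularSystem xs) (p : Ideal R) :
    ∀ [p.IsPrime] (a : Ideal R) {j : ℕ} (_ : p.height < j), ExtVanishesAt p (R ⧸ a) j := by
  induction p using WellFoundedGT.induction with
  | ind p ih =>
  intro hp a j hj
  by_cases hpm : p = maximalIdeal R
  · subst hpm; exact h.extVanishesAt_maximalIdeal a hj
  obtain ⟨p', ⟨hp'p, hp'⟩, hp'min⟩ : ∃ p' : Ideal R, (p'.IsPrime ∧ p < p') ∧
      ∀ q : Ideal R, (q.IsPrime ∧ p < q) → p'.height ≤ q.height := by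
    have hne : {p' : Ideal R | p'.IsPrime ∧ p < p'}.Nonempty :=
      ⟨maximalIdeal R, inferInstance, lt_of_le_of_ne (IsLocalRing.le_maximalIdeal hp.ne_top) hpm⟩
    have hwf := (InvImage.wf (fun I : Ideal R ↦ I.height) (wellFounded_lt (α := ℕ∞)))
    exact ⟨hwf.min _ hne, hwf.min_mem _ hne, fun q hq ↦ not_lt.mp (hwf.not_lt_min _ hq)⟩
  have hht : p'.height < (j + 1 : ℕ) := by
    by_contra hcon
    have hcon' : p.height + 2 ≤ p'.height := by
      refine le_trans ?_ (not_lt.mp hcon)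
      have h1 : p.height + 1 ≤ j := Order.add_one_le_of_lt hj
      rw [show (2 : ℕ∞) = 1 + 1 by norm_num, ← add_assoc, Nat.cast_add, Nat.cast_one]
      gcongr
    obtain ⟨q, hq, h1, h2⟩ := h.exists_isPrime_between hp'.le hcon'
    exact absurd (hp'min q ⟨hq, h1⟩)
      (not_le.mpr (Ideal.height_strict_mono_of_isPrime_of_isPrime h2))
  obtain ⟨x, hx, hxp⟩ := SetLike.exists_of_lt hp'
  let c : ℕ →o Ideal R :=
    { toFun := fun k ↦ a.colon {x ^ k}
      monotone' := monotone_nat_of_le_succ fun k r hr ↦ by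
        rw [Submodule.mem_colon_singleton, smul_eq_mul] at hr ⊢
        rw [pow_succ, ← mul_assoc]
        exact a.mul_mem_right _ hr }
  obtain ⟨k, hk⟩ := monotone_stabilizes_iff_noetherian.mpr ‹_› c
  have hck : ∀ k r, r ∈ c k ↔ r * x ^ k ∈ a := fun k r ↦ Submodule.mem_colon_singleton
  obtain ⟨f, g, hfx, hf, hfg, hg⟩ := exists_shortExact_colon a (c k) (x ^ k) (hck k)
  refine .of_exact hf hfg hg (.mono ?_ hp'.le) (.of_smul_eq_zero (z := x ^ k) ?_ ?_)
  · obtain ⟨f, g, hfx, hf, hfg, hg⟩ := exists_shortExact_colon (c k) (c k) x fun r ↦ by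
      rw [hck k (r * x), mul_assoc, ← pow_succ', ← hck, ← hk (k + 1) (by omega)]
    refine ExtVanishesAt.of_exact_smul hx (f := f) (fun m ↦ ?_) hf hfg hg
      (ih p' hp' _ (j := j + 1) hht)
    obtain ⟨m, rfl⟩ := Ideal.Quotient.mk_surjective m
    rw [hfx, mul_comm]
    rfl
  · exact fun hmem ↦ hxp (hp.mem_of_pow_mem _ hmem)
  · intro m
    obtain ⟨m, rfl⟩ := Ideal.Quotient.mk_surjective m
    change Ideal.Quotient.mk _ (x ^ k * m) = 0
    rw [Ideal.Quotient.eq_zero_iff_mem]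
    exact Submodule.mem_sup_right (Ideal.mul_mem_right _ _ (Ideal.mem_span_singleton_self _))

section

open CategoryTheory Abelian

variable {R : Type u} [CommRing R]

theorem exists_mk₀_comp_bijective (zs : List R) :
    ∀ {L Q : Type u} [AddCommGroup L] [Module R L] [AddCommGroup Q] [Module R Q]
      (_ : IsWeaklyRegular L zs) (_ : Q ≃ₗ[R] L ⧸ Ideal.ofList zs • (⊤ : Submodule R L)),
      ∃ α : ModuleExt R Q L zs.length, ∀ (N : Type u) [AddCommGroup N] [Module R N],
        (∀ z ∈ zs, ∀ n : N, z • n = 0) →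
        (∀ i < zs.length, Subsingleton (ModuleExt R N L i)) ∧
        Function.Bijective fun f : N →ₗ[R] Q ↦
          (Ext.mk₀ (ModuleCat.ofHom f)).comp α (zero_add _) := by
  induction zs with
  | nil =>
    intro L Q _ _ _ _ _ e
    let e' : Q ≃ₗ[R] L := e.trans (Submodule.quotEquivOfEqBot _ (by simp))
    refine ⟨Ext.mk₀ (ModuleCat.ofHom (e' : Q →ₗ[R] L)), fun N _ _ _ ↦ ⟨by simp, ?_⟩⟩
    have h1 : (fun f : N →ₗ[R] Q ↦ (Ext.mk₀ (ModuleCat.ofHom f)).comp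
        (Ext.mk₀ (ModuleCat.ofHom (e' : Q →ₗ[R] L))) (zero_add _)) =
        Ext.addEquiv₀.symm ∘ ModuleCat.homLinearEquiv (S := R).symm ∘ e'.congrRight (M := N) := by
      ext1 f
      rw [Ext.mk₀_comp_mk₀]
      rfl
    exact h1 ▸ Ext.addEquiv₀.symm.bijective.comp
      (ModuleCat.homLinearEquiv.symm.bijective.comp (LinearEquiv.bijective _))
  | cons z zs ih =>
    intro L Q _ _ _ _ hreg e
    rw [isWeaklyRegular_cons_iff] at hreg
    obtain ⟨α, hα⟩ := ih hreg.2
      (e.trans (Submodule.quotOfListConsSMulTopEquivQuotSMulTopInner L z zs))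
    have hreg1 : IsSMulRegular (ModuleCat.of R L) z := hreg.1
    have hS := hreg1.smulShortComplex_shortExact
    let ξ : ModuleExt R (QuotSMulTop z L) L 1 := hS.extClass
    refine ⟨α.comp ξ rfl, fun N _ _ hN ↦ ?_⟩
    obtain ⟨hvan, hbij⟩ := hα N fun w hw ↦ hN w (by simp [hw])
    have hsurj : ∀ (i : ℕ) (x : ModuleExt R N L (i + 1)),
        ∃ y : ModuleExt R N (QuotSMulTop z L) i, y.comp ξ rfl = x := by
      intro i x
      refine Ext.covariant_sequence_exact₁ (ModuleCat.of R N) hS x ?_ rfl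
      rw [ModuleCat.smulShortComplex_f_eq_smul_id]
      exact (Ext.smul_eq_comp_mk₀ x z).symm.trans
        (ModuleExt.smul_eq_zero_of_forall (hN z (by simp)) _ x)
    have hinj : ∀ (i : ℕ) (y : ModuleExt R N (QuotSMulTop z L) i),
        Subsingleton (ModuleExt R N L i) → y.comp ξ rfl = 0 → y = 0 := by
      intro i y hsub hy
      obtain ⟨w, hw⟩ := Ext.covariant_sequence_exact₃ (ModuleCat.of R N) hS y rfl hy
      have hw0 : w = 0 := hsub.elim w 0
      rw [← hw, hw0, Ext.zero_comp]
      rfl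
    have hvan' : ∀ i < (z :: zs).length, Subsingleton (ModuleExt R N L i) := by
      intro i hi
      refine subsingleton_of_forall_eq 0 fun x ↦ ?_
      cases i with
      | zero =>
        obtain ⟨φ, rfl⟩ := Ext.addEquiv₀.symm.surjective x
        have h2 : φ = 0 := by
          ext n
          refine hreg.1 ?_
          change z • φ.hom n = z • (0 : L)
          rw [← map_smul, hN z (by simp), map_zero, smul_zero]
        rw [h2, map_zero]
      | succ i =>
        have := hvan i (by simpa using hi)
        obtain ⟨y, rfl⟩ := hsurj i x
        rw [Subsingleton.elim y 0, Ext.zero_comp]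
    refine ⟨hvan', ?_⟩
    have h2 : ∀ f : N →ₗ[R] Q, (Ext.mk₀ (ModuleCat.ofHom f)).comp (α.comp ξ rfl) (zero_add _) =
        ((Ext.mk₀ (ModuleCat.ofHom f)).comp α (zero_add _)).comp ξ rfl :=
      fun f ↦ (Ext.comp_assoc _ _ _ _ _ (by omega)).symm
    have h3 : Function.Bijective fun y : ModuleExt R N (QuotSMulTop z L) zs.length ↦
        (y.comp ξ rfl : ModuleExt R N L (zs.length + 1)) := by
      refine ⟨fun x y hxy ↦ ?_, hsurj _⟩
      rw [← sub_eq_zero]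
      refine hinj _ _ (hvan' _ (by simp)) ?_
      rw [sub_eq_add_neg, Ext.add_comp, Ext.neg_comp, ← sub_eq_add_neg]
      exact sub_eq_zero.mpr hxy
    exact (funext h2 : _ = _ ∘ _) ▸ h3.comp hbij

/-- `Ext^d(N, R) ≅ Hom(N, R/(z))` for modules killed by a weakly regular sequence of length `d`,
naturally in `N`. -/
theorem exists_linearEquiv_ext (zs : List R) (hzs : IsWeaklyRegular R zs) :
    ∃ α : ModuleExt R (R ⧸ Ideal.ofList zs) R zs.length,
      ∀ (N : Type u) [AddCommGroup N] [Module R N], (∀ z ∈ zs, ∀ n : N, z • n = 0) →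
      ∃ e : (N →ₗ[R] R ⧸ Ideal.ofList zs) ≃ₗ[R] ModuleExt R N R zs.length,
        ∀ f, e f = ModuleExt.precomp f R _ α := by
  obtain ⟨α, hα⟩ := exists_mk₀_comp_bijective zs (L := R) hzs
    (Submodule.quotEquivOfEq (Ideal.ofList zs) (Ideal.ofList zs • (⊤ : Submodule R R)) (by simp))
  refine ⟨α, fun N _ _ hN ↦ ⟨LinearEquiv.ofBijective
    { toFun := fun f ↦ ModuleExt.precomp f R _ α
      map_add' := fun f g ↦ ?_
      map_smul' := fun r f ↦ ?_ } (hα N hN).2, fun f ↦ rfl⟩⟩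
  · have : ModuleCat.ofHom (f + g) = ModuleCat.ofHom f + ModuleCat.ofHom g := rfl
    simp [ModuleExt.precomp, this, Ext.mk₀_add, Ext.add_comp]
  · have : ModuleCat.ofHom (r • f) = r • ModuleCat.ofHom f := rfl
    simp [ModuleExt.precomp, this, Ext.mk₀_smul]

/-- The connecting map `Hom(X₁, R/(z)) → Ext^{d+1}(X₃, R)`. -/
theorem exists_hom_to_ext {X₁ X₂ X₃ : Type u} [AddCommGroup X₁] [Module R X₁] [AddCommGroup X₂]
    [Module R X₂] [AddCommGroup X₃] [Module R X₃] {f : X₁ →ₗ[R] X₂} {g : X₂ →ₗ[R] X₃}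
    (hf : Function.Injective f) (hfg : Function.Exact f g) (hg : Function.Surjective g)
    (zs : List R) (hzs : IsWeaklyRegular R zs) (hX : ∀ z ∈ zs, ∀ x : X₂, z • x = 0) :
    ∃ ψ : (X₁ →ₗ[R] R ⧸ Ideal.ofList zs) →ₗ[R] ModuleExt R X₃ R (zs.length + 1),
      (∀ φ, ψ φ = 0 ↔ ∃ φ' : X₂ →ₗ[R] R ⧸ Ideal.ofList zs, φ' ∘ₗ f = φ) ∧
      (Subsingleton (ModuleExt R X₂ R (zs.length + 1)) → Function.Surjective ψ) := by
  obtain ⟨α, hα⟩ := exists_linearEquiv_ext zs hzs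
  obtain ⟨e₁, he₁⟩ := hα X₁ fun z hz x ↦ hf (by rw [map_smul, hX z hz, map_zero])
  obtain ⟨e₂, he₂⟩ := hα X₂ hX
  refine ⟨ModuleExt.connecting hf hfg hg R _ ∘ₗ e₁, fun φ ↦ ?_, fun _ c ↦ ?_⟩
  · rw [LinearMap.comp_apply, ModuleExt.exact_precomp_connecting hf hfg hg]
    constructor
    · rintro ⟨c, hc⟩
      obtain ⟨φ', rfl⟩ := e₂.surjective c
      refine ⟨φ', e₁.injective ?_⟩
      rw [he₁, ModuleExt.precomp_comp, ← he₂]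
      exact hc
    · rintro ⟨φ', rfl⟩
      exact ⟨e₂ φ', by rw [LinearEquiv.coe_coe, he₁, ModuleExt.precomp_comp, ← he₂]⟩
  · obtain ⟨b, hb⟩ := (ModuleExt.exact_connecting_precomp hf hfg hg (Y := R) _ c).mp
      (Subsingleton.elim _ _)
    exact ⟨e₁.symm b, by simpa using hb⟩

end

section

open CategoryTheory Abelian

namespace CategoryTheory.ProjectiveResolution

theorem eq_zero_of_extMk_eq_zero {C : Type*} [Category* C] [Abelian C] [HasExt C] {X Y : C}
    (P : ProjectiveResolution X) (f : P.complex.X 0 ⟶ Y) (m : ℕ) (hm : 0 + 1 = m)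
    (hf : P.complex.d m 0 ≫ f = 0) (h : P.extMk f m hm hf = 0) : f = 0 := by
  simp only [← P.extEquivCohomologyClass.apply_eq_iff_eq,
    extEquivCohomologyClass_extMk, extEquivCohomologyClass_zero,
    CochainComplex.HomComplex.CohomologyClass.mk_eq_zero_iff] at h
  rw [CochainComplex.HomComplex.Cocycle.toSingleMk_mem_coboundaries_iff _ _ _ _ _ (1 : ℤ)
    (by lia)] at h
  obtain ⟨g, hg⟩ := h
  have h0 : g = 0 := (P.cochainComplex.isZero_of_isStrictlyLE 0 1 (by lia)).eq_of_src _ _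
  rw [← cancel_epi (P.cochainComplexXIso (-(0 : ℕ)) 0 rfl).hom, ← hg, h0]
  simp

variable {R : Type u} [CommRing R] {X : ModuleCat.{u} R} (P : ProjectiveResolution X)
  (Y : ModuleCat.{u} R) (n : ℕ)

/-- The maps from the `n`-th term of a projective resolution that vanish on boundaries. -/
def homCocycles : Submodule R (P.complex.X n ⟶ Y) :=
  LinearMap.ker (Linear.leftComp R Y (P.complex.d (n + 1) n))

variable {Y n} in
theorem d_comp_homCocycles (f : P.homCocycles Y n) : P.complex.d (n + 1) n ≫ f.1 = 0 :=
  LinearMap.mem_ker.1 f.2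

/-- The class in `Ext` of a cocycle. -/
noncomputable def cocycleToExt : P.homCocycles Y n →ₗ[R] Abelian.Ext X Y n where
  toFun f := P.extMk f.1 (n + 1) rfl (P.d_comp_homCocycles f)
  map_add' f g := (P.add_extMk ..).symm
  map_smul' r f := by
    rw [RingHom.id_apply, Ext.smul_eq_comp_mk₀, extMk_comp_mk₀]
    congr 1

theorem cocycleToExt_surjective : Function.Surjective (P.cocycleToExt Y n) := fun α ↦ by
  obtain ⟨f, hf, rfl⟩ := P.extMk_surjective α (n + 1) rfl
  exact ⟨⟨f, hf⟩, rfl⟩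

theorem cocycleToExt_eq_zero_iff (f : P.homCocycles Y n) :
    P.cocycleToExt Y n f = 0 ↔
      ∃ g, P.complex.d n ((ComplexShape.down ℕ).next n) ≫ g = f.1 := by
  cases n with
  | zero =>
    refine ⟨fun h ↦ ⟨0, ?_⟩, ?_⟩
    · rw [P.eq_zero_of_extMk_eq_zero _ 1 rfl (P.d_comp_homCocycles f) h]; simp
    · rintro ⟨g, hg⟩
      rw [P.complex.shape _ _ (by simp)] at hg
      obtain rfl : f = 0 := Subtype.ext (by simp [← hg])
      simp
  | succ n =>
    rw [ChainComplex.next_nat_succ]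
    exact P.extMk_eq_zero_iff _ _ rfl (P.d_comp_homCocycles f) _ rfl

/-- The classes of cocycles in `Abelian.Ext` compute the cohomology of the complex of maps out of
a projective resolution. -/
noncomputable def homologyLinearEquivExt :
    (P.complex.linearYonedaObj R Y).homology n ≃ₗ[R] Abelian.Ext X Y n := by
  let S := (P.complex.linearYonedaObj R Y).sc n
  have hS : ∀ f : P.complex.X n ⟶ Y, f ∈ LinearMap.ker S.g.hom ↔ f ∈ P.homCocycles Y n := by
    intro f
    change P.complex.d ((ComplexShape.up ℕ).next n) n ≫ f = 0 ↔ P.complex.d (n + 1) n ≫ f = 0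
    rw [CochainComplex.next]
  let c : LinearMap.ker S.g.hom →ₗ[R] P.homCocycles Y n :=
    { toFun f := ⟨f.1, (hS f.1).1 f.2⟩
      map_add' _ _ := rfl
      map_smul' _ _ := rfl }
  have hc : Function.Surjective c := fun f ↦ ⟨⟨f.1, (hS f.1).2 f.2⟩, rfl⟩
  have hker : LinearMap.range S.moduleCatToCycles = LinearMap.ker (P.cocycleToExt Y n ∘ₗ c) := by
    ext f
    rw [LinearMap.mem_ker, LinearMap.comp_apply, P.cocycleToExt_eq_zero_iff]
    refine ⟨?_, ?_⟩
    · rintro ⟨g, rfl⟩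
      exact ⟨g, rfl⟩
    · rintro ⟨g, hg⟩
      exact ⟨g, Subtype.ext hg⟩
  exact S.moduleCatHomologyIso.toLinearEquiv ≪≫ₗ Submodule.quotEquivOfEq _ _ hker ≪≫ₗ
    (P.cocycleToExt Y n ∘ₗ c).quotKerEquivOfSurjective ((P.cocycleToExt_surjective Y n).comp hc)

end CategoryTheory.ProjectiveResolution

theorem nonempty_linearEquiv_moduleExt {R : Type u} [CommRing R] (M N : Type u) [AddCommGroup M]
    [Module R M] [AddCommGroup N] [Module R N] (n : ℕ) :
    Nonempty ((((Ext R (ModuleCat.{u} R) n).obj (Opposite.op (ModuleCat.of R M))).obj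
      (ModuleCat.of R N)) ≃ₗ[R] ModuleExt R M N n) :=
  ⟨((projectiveResolution (ModuleCat.of R M)).isoExt n (ModuleCat.of R N)).toLinearEquiv ≪≫ₗ
    (projectiveResolution (ModuleCat.of R M)).homologyLinearEquivExt _ n⟩

end

section SerreConditions

theorem SerreS.exists_of_one_le {A : Type u} [CommRing A] (hS : SerreS A 2) {P : Ideal A}
    [P.IsPrime] (hP : 1 ≤ P.height) : ∃ a ∈ P, ∀ x, a * x = 0 → ∃ s ∉ P, s * x = 0 := by
  obtain ⟨rs, hlen, hmem, hrs⟩ := hS P ‹_› 1 (by lia) (by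
    rw [IsLocalization.AtPrime.ringKrullDim_eq_height P]; exact_mod_cast hP)
  obtain ⟨r, rfl⟩ := List.length_eq_one_iff.1 hlen
  obtain ⟨⟨a, t⟩, hat⟩ := IsLocalization.surj P.primeCompl r
  have hr := ((isWeaklyRegular_cons_iff _ _ _).1 hrs).1
  refine ⟨a, ?_, fun x hx ↦ ?_⟩
  · rw [← IsLocalization.AtPrime.to_map_mem_maximal_iff (Localization.AtPrime P) P]
    exact hat ▸ Ideal.mul_mem_right _ _ (hmem r (by simp))
  · have h0 : algebraMap A (Localization.AtPrime P) x = 0 := by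
      refine (IsLocalization.map_units (Localization.AtPrime P) t).mul_right_eq_zero.1
        (hr.right_eq_zero_of_smul ?_)
      rw [smul_eq_mul, ← mul_assoc]
      simp only at hat
      rw [hat, ← map_mul, hx, map_zero]
    obtain ⟨s, hs⟩ := (IsLocalization.map_eq_zero_iff P.primeCompl _ x).1 h0
    exact ⟨s, s.2, hs⟩

theorem SerreS.exists_of_two_le {A : Type u} [CommRing A] (hS : SerreS A 2) {P : Ideal A}
    [P.IsPrime] (hP : 2 ≤ P.height) : ∃ a ∈ P, ∃ b ∈ P, (∀ x, a * x = 0 → ∃ s ∉ P, s * x = 0) ∧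
      ∀ x y, a * x = b * y → ∃ s ∉ P, ∃ w, s * y = a * w := by
  obtain ⟨rs, hlen, hmem, hrs⟩ := hS P ‹_› 2 (by lia) (by
    rw [IsLocalization.AtPrime.ringKrullDim_eq_height P]; exact WithBot.coe_le_coe.2 hP)
  obtain ⟨r, r', rfl⟩ := List.length_eq_two.1 hlen
  obtain ⟨⟨a, t⟩, hat⟩ := IsLocalization.surj P.primeCompl r
  obtain ⟨⟨b, t'⟩, hbt⟩ := IsLocalization.surj P.primeCompl r'
  obtain ⟨hr, hrs'⟩ := (isWeaklyRegular_cons_iff _ _ _).1 hrs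
  have hr' := ((isWeaklyRegular_cons_iff _ _ _).1 hrs').1
  simp only at hat hbt
  refine ⟨a, ?_, b, ?_, fun x hx ↦ ?_, fun x y hxy ↦ ?_⟩
  · rw [← IsLocalization.AtPrime.to_map_mem_maximal_iff (Localization.AtPrime P) P]
    exact hat ▸ Ideal.mul_mem_right _ _ (hmem r (by simp))
  · rw [← IsLocalization.AtPrime.to_map_mem_maximal_iff (Localization.AtPrime P) P]
    exact hbt ▸ Ideal.mul_mem_right _ _ (hmem r' (by simp))
  · have h0 : algebraMap A (Localization.AtPrime P) x = 0 := by
      refine (IsLocalization.map_units (Localization.AtPrime P) t).mul_right_eq_zero.1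
        (hr.right_eq_zero_of_smul ?_)
      rw [smul_eq_mul, ← mul_assoc, hat, ← map_mul, hx, map_zero]
    obtain ⟨s, hs⟩ := (IsLocalization.map_eq_zero_iff P.primeCompl _ x).1 h0
    exact ⟨s, s.2, hs⟩
  · have h0 : algebraMap A (Localization.AtPrime P) (t' * y) ∈
        r • (⊤ : Submodule (Localization.AtPrime P) (Localization.AtPrime P)) := by
      rw [← Submodule.Quotient.mk_eq_zero]
      refine hr'.right_eq_zero_of_smul ?_
      rw [← Submodule.Quotient.mk_smul, Submodule.Quotient.mk_eq_zero, smul_eq_mul, map_mul,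
        ← mul_assoc, hbt, ← map_mul, ← hxy, map_mul, ← hat, mul_assoc]
      exact Submodule.smul_mem_pointwise_smul _ _ _ trivial
    obtain ⟨v, -, hv⟩ := h0
    obtain ⟨⟨w, t''⟩, hw⟩ := IsLocalization.surj P.primeCompl v
    simp only at hw
    have h1 : algebraMap A (Localization.AtPrime P) (t * (t' * y) * t'') =
        algebraMap A (Localization.AtPrime P) (a * w) := by
      rw [map_mul, map_mul _ (t : A), map_mul _ a, ← hv, ← hat, ← hw]
      change _ * (r * v) * _ = _
      ring
    obtain ⟨s, hs⟩ := (IsLocalization.eq_iff_exists P.primeCompl _).1 h1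
    refine ⟨s * t * t' * t'', (s * t * t' * t'').2, s * w, ?_⟩
    linear_combination hs

variable {R : Type u} [CommRing R] {I : Ideal R}

theorem Ideal.map_quotientMk_lt_map_quotientMk {q p : Ideal R} (hI : I ≤ q) (hqp : q < p) :
    q.map (Ideal.Quotient.mk I) < p.map (Ideal.Quotient.mk I) := by
  refine lt_of_le_of_ne (Ideal.map_mono hqp.le) fun h ↦ hqp.ne ?_
  simpa [Ideal.comap_map_quotientMk, hI, hI.trans hqp.le] using
    congrArg (Ideal.comap (Ideal.Quotient.mk I)) h

theorem Ideal.mk_mem_map_quotientMk_iff {p : Ideal R} (hI : I ≤ p) {x : R} :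
    Ideal.Quotient.mk I x ∈ p.map (Ideal.Quotient.mk I) ↔ x ∈ p := by
  rw [← Ideal.mem_comap, Ideal.comap_map_quotientMk, sup_eq_right.2 hI]

theorem SerreS.exists_of_lt (hS : SerreS (R ⧸ I) 2) {q p : Ideal R}
    [q.IsPrime] [p.IsPrime] (hI : I ≤ q) (hqp : q < p) :
    ∃ a ∈ p, ∀ x, a * x ∈ I → ∃ s ∉ p, s * x ∈ I := by
  have hIp := hI.trans hqp.le
  have := Ideal.isPrime_map_quotientMk_of_isPrime hI
  have := Ideal.isPrime_map_quotientMk_of_isPrime hIp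
  obtain ⟨a, ha, h⟩ := hS.exists_of_one_le (P := p.map (Ideal.Quotient.mk I)) (le_trans
    (by simp) (Ideal.height_add_one_le_of_lt_of_isPrime
      (Ideal.map_quotientMk_lt_map_quotientMk hI hqp)))
  obtain ⟨a, rfl⟩ := Ideal.Quotient.mk_surjective a
  refine ⟨a, (Ideal.mk_mem_map_quotientMk_iff hIp).1 ha, fun x hx ↦ ?_⟩
  obtain ⟨s, hs, hsx⟩ := h (Ideal.Quotient.mk I x)
    (by rwa [← map_mul, Ideal.Quotient.eq_zero_iff_mem])
  obtain ⟨s, rfl⟩ := Ideal.Quotient.mk_surjective s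
  exact ⟨s, fun h ↦ hs ((Ideal.mk_mem_map_quotientMk_iff hIp).2 h),
    by rwa [← map_mul, Ideal.Quotient.eq_zero_iff_mem] at hsx⟩

theorem SerreS.exists_of_lt_of_lt (hS : SerreS (R ⧸ I) 2) {q q₁ p : Ideal R}
    [q.IsPrime] [q₁.IsPrime] [p.IsPrime] (hI : I ≤ q) (hq : q < q₁) (hq₁ : q₁ < p) :
    ∃ a ∈ p, ∃ b ∈ p, (∀ x, a * x ∈ I → ∃ s ∉ p, s * x ∈ I) ∧
      ∀ x y, a * x - b * y ∈ I → ∃ s ∉ p, ∃ w, s * y - a * w ∈ I := by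
  have hIq₁ := hI.trans hq.le
  have hIp := hIq₁.trans hq₁.le
  have := Ideal.isPrime_map_quotientMk_of_isPrime hI
  have := Ideal.isPrime_map_quotientMk_of_isPrime hIq₁
  have := Ideal.isPrime_map_quotientMk_of_isPrime hIp
  have h₁ := Ideal.height_add_one_le_of_lt_of_isPrime
    (Ideal.map_quotientMk_lt_map_quotientMk hI hq)
  have h₂ := Ideal.height_add_one_le_of_lt_of_isPrime
    (Ideal.map_quotientMk_lt_map_quotientMk hIq₁ hq₁)
  obtain ⟨a, ha, b, hb, h, h'⟩ := hS.exists_of_two_le (P := p.map (Ideal.Quotient.mk I)) (by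
    refine le_trans (le_trans ?_ (add_le_add_left h₁ 1)) h₂
    rw [add_assoc, one_add_one_eq_two]
    exact le_add_self)
  obtain ⟨a, rfl⟩ := Ideal.Quotient.mk_surjective a
  obtain ⟨b, rfl⟩ := Ideal.Quotient.mk_surjective b
  refine ⟨a, (Ideal.mk_mem_map_quotientMk_iff hIp).1 ha, b,
    (Ideal.mk_mem_map_quotientMk_iff hIp).1 hb, fun x hx ↦ ?_, fun x y hxy ↦ ?_⟩
  · obtain ⟨s, hs, hsx⟩ := h (Ideal.Quotient.mk I x)
      (by rwa [← map_mul, Ideal.Quotient.eq_zero_iff_mem])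
    obtain ⟨s, rfl⟩ := Ideal.Quotient.mk_surjective s
    exact ⟨s, fun h ↦ hs ((Ideal.mk_mem_map_quotientMk_iff hIp).2 h),
      by rwa [← map_mul, Ideal.Quotient.eq_zero_iff_mem] at hsx⟩
  · obtain ⟨s, hs, w, hw⟩ := h' (Ideal.Quotient.mk I x) (Ideal.Quotient.mk I y)
      (by rwa [← map_mul, ← map_mul, Ideal.Quotient.eq])
    obtain ⟨s, rfl⟩ := Ideal.Quotient.mk_surjective s
    obtain ⟨w, rfl⟩ := Ideal.Quotient.mk_surjective w
    exact ⟨s, fun h ↦ hs ((Ideal.mk_mem_map_quotientMk_iff hIp).2 h), w,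
      by rwa [← map_mul, ← map_mul, Ideal.Quotient.eq] at hw⟩

end SerreConditions

section Connectedness

variable {R : Type u} [CommRing R] {I : Ideal R}

/-- Let `0 → R/I → G → C → 0` be exact. If `a, b ∈ p` form a regular sequence on `R/I` at `p`, and
`p` is not associated to `G`, then it is not associated to `C`. -/
theorem notMem_associatedPrimes_of_exact [IsNoetherianRing R] {p : Ideal R} [p.IsPrime] {a b : R}
    (ha : a ∈ p) (hb : b ∈ p) (hreg : ∀ x, a * x ∈ I → ∃ s ∉ p, s * x ∈ I)
    (hreg' : ∀ x y, a * x - b * y ∈ I → ∃ s ∉ p, ∃ w, s * y - a * w ∈ I)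
    {G C : Type u} [AddCommGroup G] [Module R G] [AddCommGroup C] [Module R C]
    (ι : R →ₗ[R] G) (hι : ∀ r, ι r = 0 ↔ r ∈ I) (ψ : G →ₗ[R] C)
    (hψ : ∀ g, ψ g = 0 ↔ ∃ r, ι r = g) (hψs : Function.Surjective ψ)
    (hG : p ∉ associatedPrimes R G) : p ∉ associatedPrimes R C := by
  intro hC
  obtain ⟨-, c, hc⟩ := isAssociatedPrime_iff.mp hC
  obtain ⟨g, rfl⟩ := hψs c
  have hp : ∀ t, t ∈ p ↔ ∃ r, ι r = t • g := fun t ↦ by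
    rw [← hψ, map_smul, hc, Submodule.mem_colon_singleton, Submodule.mem_bot]
  obtain ⟨x, hx⟩ := (hp a).1 ha
  obtain ⟨y, hy⟩ := (hp b).1 hb
  have hxs : ∀ x r : R, ι (x * r) = x • ι r := fun x r ↦ by rw [← smul_eq_mul, map_smul]
  obtain ⟨s, hs, w, hw⟩ := hreg' y x (by
    rw [← hι, map_sub, hxs, hxs, hx, hy, smul_comm, sub_self])
  have hah : a • (s • g - ι w) = 0 := by
    rw [← hι, map_sub, hxs, hxs, hx] at hw
    rw [smul_sub, smul_comm, hw]
  have hth : ∀ t ∈ p, ∃ s' ∉ p, (s' * t) • (s • g - ι w) = 0 := by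
    intro t ht
    obtain ⟨r, hr⟩ := (hp t).1 ht
    have h1 : ι (s * r - t * w) = t • (s • g - ι w) := by
      rw [map_sub, hxs, hxs, hr, smul_sub, smul_comm]
    obtain ⟨s', hs', h⟩ := hreg (s * r - t * w) (by
      rw [← hι, hxs, h1, smul_comm, hah, smul_zero])
    exact ⟨s', hs', by rw [mul_smul, ← h1, ← hxs, hι]; exact h⟩
  obtain ⟨s₁, hs₁, h₁⟩ : ∃ s₁ ∉ p, ∀ t ∈ p, (s₁ * t) • (s • g - ι w) = 0 := by
    obtain ⟨S, hS⟩ := (IsNoetherian.noetherian p : p.FG)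
    have hSp : ∀ t ∈ S, t ∈ p := fun t ht ↦ hS ▸ Ideal.subset_span ht
    choose! σ hσ hσ' using hth
    refine ⟨∏ t ∈ S, σ t, fun h ↦ ?_, fun t ht ↦ ?_⟩
    · obtain ⟨t, ht, h⟩ := (Ideal.IsPrime.prod_mem_iff).1 h
      exact hσ t (hSp t ht) h
    · rw [← hS] at ht
      induction ht using Submodule.span_induction with
      | mem t ht =>
        obtain ⟨c, hc⟩ := Finset.dvd_prod_of_mem σ ht
        rw [hc, mul_right_comm, mul_comm, mul_smul, hσ' t (hSp t ht), smul_zero]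
      | zero => simp
      | add t t' _ _ h h' => rw [mul_add, add_smul, h, h', add_zero]
      | smul r t _ h => rw [smul_eq_mul, mul_left_comm, mul_smul, h, smul_zero]
  by_cases hzero : ∃ s' ∉ p, s' • (s • g - ι w) = 0
  · obtain ⟨s', hs', h⟩ := hzero
    refine ‹p.IsPrime›.mul_notMem hs' hs ((hp _).2 ⟨s' * w, ?_⟩)
    rw [hxs, mul_smul]
    rw [smul_sub, sub_eq_zero] at h
    exact h.symm
  · push Not at hzero
    refine hG (isAssociatedPrime_iff.2 ⟨‹_›, s₁ • (s • g - ι w), ?_⟩)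
    ext t
    rw [Submodule.mem_colon_singleton, Submodule.mem_bot, smul_smul, mul_comm]
    refine ⟨h₁ t, fun h ↦ ?_⟩
    by_contra ht
    exact hzero _ (‹p.IsPrime›.mul_notMem hs₁ ht) h

/-- The elements lying in the localization of `I` at each of the primes in `T`. -/
def Ideal.localIntersection (I : Ideal R) (T : Set (Ideal R)) (hT : ∀ q ∈ T, q.IsPrime) :
    Ideal R where
  carrier := {y | ∀ q ∈ T, ∃ s ∉ q, s * y ∈ I}
  add_mem' {y y'} h h' q hq := by
    obtain ⟨s, hs, hy⟩ := h q hq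
    obtain ⟨s', hs', hy'⟩ := h' q hq
    refine ⟨s * s', (hT q hq).mul_notMem hs hs', ?_⟩
    rw [show s * s' * (y + y') = s' * (s * y) + s * (s' * y') by ring]
    exact I.add_mem (I.mul_mem_left _ hy) (I.mul_mem_left _ hy')
  zero_mem' q hq := ⟨1, (Ideal.ne_top_iff_one q).1 (hT q hq).ne_top, by simp⟩
  smul_mem' r y h q hq := by
    obtain ⟨s, hs, hy⟩ := h q hq
    exact ⟨s, hs, by rw [smul_eq_mul, mul_left_comm]; exact I.mul_mem_left _ hy⟩

variable {T U : Set (Ideal R)} (hT : ∀ q ∈ T, q.IsPrime) (hU : ∀ q ∈ U, q.IsPrime)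

theorem Ideal.le_localIntersection : I ≤ I.localIntersection T hT := fun y hy q hq ↦
  ⟨1, (Ideal.ne_top_iff_one q).1 (hT q hq).ne_top, by simpa⟩

theorem Ideal.localIntersection_le {q : Ideal R} (hq : q ∈ T) (hI : I ≤ q) :
    I.localIntersection T hT ≤ q := fun y hy ↦ by
  obtain ⟨s, hs, h⟩ := hy q hq
  exact ((hT q hq).mem_or_mem (hI h)).resolve_left hs

theorem Ideal.mem_of_mem_localIntersection [IsNoetherianRing R]
    (hI : associatedPrimes R (R ⧸ I) ⊆ T ∪ U) {y : R} (hy : y ∈ I.localIntersection T hT)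
    (hy' : y ∈ I.localIntersection U hU) : y ∈ I := by
  by_contra h
  have hne : (I.colon {y} : Ideal R) ≠ ⊤ := fun h' ↦ h (by
    have := (Ideal.eq_top_iff_one _).1 h'
    simpa [Submodule.mem_colon_singleton] using this)
  obtain ⟨m, hm, hle⟩ := Ideal.exists_le_maximal _ hne
  have := hm.isPrime
  obtain ⟨q, hq, hann, -⟩ := exists_mem_associatedPrimes_le m (Ideal.Quotient.mk I y) fun s hs ↦
    hle (Submodule.mem_colon_singleton.2 (Ideal.Quotient.eq_zero_iff_mem.1 hs))
  obtain ⟨s, hs, h⟩ : ∃ s ∉ q, s * y ∈ I := by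
    rcases hI hq with hq | hq
    exacts [hy q hq, hy' q hq]
  exact hs (hann s (Ideal.Quotient.eq_zero_iff_mem.2 h))

theorem Ideal.associatedPrimes_quotient_localIntersection_subset [IsNoetherianRing R]
    (hI : T ⊆ I.minimalPrimes) :
    associatedPrimes R (R ⧸ I.localIntersection T hT) ⊆ T := by
  intro p hp
  obtain ⟨hpp, m, hm⟩ := isAssociatedPrime_iff.mp hp
  obtain ⟨y, rfl⟩ := Ideal.Quotient.mk_surjective m
  have hmem : ∀ t, t ∈ p ↔ t * y ∈ I.localIntersection T hT := fun t ↦ by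
    rw [hm, Submodule.mem_colon_singleton, Submodule.mem_bot, ← Ideal.Quotient.eq_zero_iff_mem]
    rfl
  have hy : y ∉ I.localIntersection T hT := fun h ↦
    hpp.ne_top ((Ideal.eq_top_iff_one p).2 ((hmem 1).2 (by simpa)))
  obtain ⟨q, hq, h⟩ : ∃ q ∈ T, ∀ s ∉ q, s * y ∉ I := by
    by_contra! h
    exact hy h
  have hpq : p ≤ q := fun t ht ↦ by
    obtain ⟨s, hs, hst⟩ := (hmem t).1 ht q hq
    by_contra htq
    exact h _ ((hT q hq).mul_notMem hs htq) (by rwa [mul_assoc])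
  have hIp : I ≤ p := fun t ht ↦ (hmem t).2
    (Ideal.le_localIntersection hT (I.mul_mem_right _ ht))
  rwa [le_antisymm hpq ((hI hq).2 ⟨hpp, hIp⟩ hpq)]

theorem Ideal.mem_minimalPrimes_of_mem_associatedPrimes_of_serreS [IsNoetherianRing R]
    (hS : SerreS (R ⧸ I) 2) {p : Ideal R} (hp : p ∈ associatedPrimes R (R ⧸ I)) :
    p ∈ I.minimalPrimes := by
  obtain ⟨hpp, m, hm⟩ := isAssociatedPrime_iff.mp hp
  obtain ⟨y, rfl⟩ := Ideal.Quotient.mk_surjective m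
  have hmem : ∀ t, t ∈ p ↔ t * y ∈ I := fun t ↦ by
    rw [hm, Submodule.mem_colon_singleton, Submodule.mem_bot, ← Ideal.Quotient.eq_zero_iff_mem]
    rfl
  have hIp : I ≤ p := fun t ht ↦ (hmem t).2 (I.mul_mem_right _ ht)
  refine ⟨⟨hpp, hIp⟩, fun q ⟨hq, hIq⟩ hqp ↦ ?_⟩
  by_contra hpq
  obtain ⟨a, ha, h⟩ := hS.exists_of_lt hIq (lt_of_le_not_ge hqp hpq)
  obtain ⟨s, hs, hsy⟩ := h y ((hmem a).1 ha)
  exact hs ((hmem s).2 hsy)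

end Connectedness

section Unmixedness

variable {R : Type u} [CommRing R] {I : Ideal R}

theorem Ideal.exists_mem_associatedPrimes_quotient_le [IsNoetherianRing R] {J p : Ideal R}
    [p.IsPrime] (h : J ≤ p) : ∃ q ∈ associatedPrimes R (R ⧸ J), q ≤ p := by
  obtain ⟨q, hq, hqp⟩ := Ideal.exists_minimalPrimes_le h
  refine ⟨q, ?_, hqp⟩
  apply Module.associatedPrimes.minimalPrimes_annihilator_subset_associatedPrimes R (R ⧸ J)
  rwa [Ideal.annihilator_quotient]

theorem Ideal.le_of_mem_associatedPrimes_quotient [IsNoetherianRing R] {J p : Ideal R}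
    (h : p ∈ associatedPrimes R (R ⧸ J)) : J ≤ p := fun a ha ↦
  le_of_mem_associatedPrimes_of_forall_smul_eq_zero h fun m ↦ by
    obtain ⟨y, rfl⟩ := Ideal.Quotient.mk_surjective m
    exact Ideal.Quotient.eq_zero_iff_mem.2 (J.mul_mem_right y ha)

/-- Over a regular local ring, the minimal primes of an ideal whose quotient satisfies `S_2` have
the same height. -/
theorem Ideal.height_eq_of_mem_minimalPrimes_of_serreS [IsNoetherianRing R] [IsLocalRing R]
    [IsDomain R] {xs : List R} (hx : IsRegularSystem xs) (hS : SerreS (R ⧸ I) 2) {d : ℕ}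
    (hd : ∃ P : Ideal R, P.IsPrime ∧ I ≤ P ∧ P.height = d)
    (hd' : ∀ P : Ideal R, P.IsPrime → I ≤ P → d ≤ P.height) {p : Ideal R}
    (hp : p ∈ I.minimalPrimes) : p.height = d := by
  by_contra hpd
  let T := {q ∈ I.minimalPrimes | q.height = d}
  let U := {q ∈ I.minimalPrimes | q.height ≠ d}
  have hT : ∀ q ∈ T, q.IsPrime := fun q hq ↦ hq.1.1.1
  have hU : ∀ q ∈ U, q.IsPrime := fun q hq ↦ hq.1.1.1
  have hTU : associatedPrimes R (R ⧸ I) ⊆ T ∪ U := fun q hq ↦ by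
    have := Ideal.mem_minimalPrimes_of_mem_associatedPrimes_of_serreS hS hq
    by_cases h : q.height = d
    exacts [Or.inl ⟨this, h⟩, Or.inr ⟨this, h⟩]
  let J := I.localIntersection T hT
  let K := I.localIntersection U hU
  have hJ := Ideal.associatedPrimes_quotient_localIntersection_subset (I := I) hT fun q hq ↦ hq.1
  have hK := Ideal.associatedPrimes_quotient_localIntersection_subset (I := I) hU fun q hq ↦ hq.1
  have hJm : J ≤ maximalIdeal R := by
    obtain ⟨P, hP, hIP, hPd⟩ := hd
    obtain ⟨q, hq, hqP⟩ := Ideal.exists_minimalPrimes_le hIP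
    have := hq.1.1
    have hqT : q ∈ T := ⟨hq, le_antisymm (hPd ▸ Ideal.height_mono hqP) (hd' q this hq.1.2)⟩
    exact (Ideal.localIntersection_le hT hqT hq.1.2).trans (le_maximalIdeal this.ne_top)
  have hKm : K ≤ maximalIdeal R :=
    (Ideal.localIntersection_le hU (q := p) ⟨hp, hpd⟩ hp.1.2).trans
      (le_maximalIdeal hp.1.1.ne_top)
  have hne : J ⊔ K ≠ ⊤ := fun h ↦
    (maximalIdeal.isMaximal R).ne_top (top_le_iff.1 (h ▸ sup_le hJm hKm))
  have : Nontrivial (R ⧸ J ⊔ K) := Ideal.Quotient.nontrivial_iff.2 hne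
  obtain ⟨P, hP⟩ := associatedPrimes.nonempty R (R ⧸ J ⊔ K)
  have hPp : P.IsPrime := hP.isPrime
  have hle := Ideal.le_of_mem_associatedPrimes_quotient hP
  obtain ⟨q, hq, hqP⟩ := Ideal.exists_mem_associatedPrimes_quotient_le (le_sup_left.trans hle)
  obtain ⟨q', hq', hqP'⟩ := Ideal.exists_mem_associatedPrimes_quotient_le (le_sup_right.trans hle)
  replace hq := hJ hq
  replace hq' := hK hq'
  have hqp := hT q hq
  have hqp' := hU q' hq'
  have hltq : q < P := by
    refine lt_of_le_of_ne hqP fun h ↦ hq'.2 ?_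
    rw [← hq.2, le_antisymm (h ▸ hqP') (hq.1.2 ⟨hqp', hq'.1.1.2⟩ (h ▸ hqP'))]
  have hltq' : q' < P := by
    refine lt_of_le_of_ne hqP' fun h ↦ hq'.2 ?_
    rw [← hq.2, le_antisymm (h ▸ hqP) (hq'.1.2 ⟨hqp, hq.1.1.2⟩ (h ▸ hqP))]
  have hht : q.height + 2 ≤ P.height := by
    have h1 : q.height + 1 ≤ q'.height := by
      rw [hq.2]
      exact Order.add_one_le_of_lt (lt_of_le_of_ne (hd' q' hqp' hq'.1.1.2) (Ne.symm hq'.2))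
    rw [← one_add_one_eq_two, ← add_assoc]
    exact (add_le_add_left h1 1).trans (Ideal.height_add_one_le_of_lt_of_isPrime hltq')
  obtain ⟨q₁, hq₁, hqq₁, hq₁P⟩ := hx.exists_isPrime_between hqP hht
  obtain ⟨a, ha, b, hb, hreg, hreg'⟩ := hS.exists_of_lt_of_lt hq.1.1.2 hqq₁ hq₁P
  refine notMem_associatedPrimes_of_exact ha hb hreg hreg' (J.mkQ.prod K.mkQ) (fun r ↦ ?_)
    ((Submodule.factor le_sup_left).coprod (-Submodule.factor le_sup_right) :
      (R ⧸ J) × (R ⧸ K) →ₗ[R] R ⧸ J ⊔ K) ?_ ?_ ?_ hP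
  · change (Submodule.Quotient.mk r, Submodule.Quotient.mk r) = ((0, 0) : (R ⧸ J) × (R ⧸ K)) ↔ _
    rw [Prod.mk.injEq,
      Submodule.Quotient.mk_eq_zero, Submodule.Quotient.mk_eq_zero]
    exact ⟨fun h ↦ Ideal.mem_of_mem_localIntersection hT hU hTU h.1 h.2,
      fun h ↦ ⟨Ideal.le_localIntersection hT h, Ideal.le_localIntersection hU h⟩⟩
  · rintro ⟨u, v⟩
    obtain ⟨x, rfl⟩ := Submodule.Quotient.mk_surjective _ u
    obtain ⟨y, rfl⟩ := Submodule.Quotient.mk_surjective _ v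
    rw [LinearMap.coprod_apply, LinearMap.neg_apply, ← sub_eq_add_neg]
    change Submodule.Quotient.mk x - Submodule.Quotient.mk y = 0 ↔ _
    rw [← Submodule.Quotient.mk_sub, Submodule.Quotient.mk_eq_zero, Submodule.mem_sup]
    constructor
    · rintro ⟨j, hj, k, hk, hjk⟩
      refine ⟨x - j, Prod.ext ((Submodule.Quotient.eq _).2 ?_) ((Submodule.Quotient.eq _).2 ?_)⟩
      · simpa using hj
      · convert hk using 1
        linear_combination -hjk
    · rintro ⟨r, hr⟩
      rw [Prod.ext_iff] at hr
      refine ⟨x - r, ?_, r - y, ?_, by ring⟩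
      · exact (Submodule.Quotient.eq J).1 hr.1.symm
      · exact (Submodule.Quotient.eq K).1 hr.2
  · intro c
    obtain ⟨x, rfl⟩ := Submodule.Quotient.mk_surjective _ c
    exact ⟨(Submodule.Quotient.mk x, 0), by simp⟩
  · rw [associatedPrimes.prod]
    rintro (h | h)
    · exact hltq'.not_ge ((hJ h).1.2 ⟨hqp', hq'.1.1.2⟩ hqP')
    · exact hltq.not_ge ((hK h).1.2 ⟨hqp, hq.1.1.2⟩ hqP)

end Unmixedness

section Linkage

variable {R : Type u} [CommRing R] {I : Ideal R} {xs zs : List R}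

theorem IsRegularSystem.height_le_length_of_smul_eq_zero [IsNoetherianRing R] [IsLocalRing R]
    (hx : IsRegularSystem xs) (hzs : IsWeaklyRegular R zs) {p : Ideal R}
    {m : R ⧸ Ideal.ofList zs} (hm : m ≠ 0) (hp : ∀ t ∈ p, t • m = 0) :
    p.height ≤ zs.length := by
  obtain ⟨q, hq, hmq, -⟩ := exists_mem_associatedPrimes_le (maximalIdeal R) m fun s hs ↦ by
    by_contra h
    exact hm ((IsLocalRing.notMem_maximalIdeal.1 h).smul_eq_zero.1 hs)
  exact (Ideal.height_mono fun t ht ↦ hmq t (hp t ht)).trans (hx.height_le_length hzs hq)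

variable [IsNoetherianRing R] [IsLocalRing R] [IsDomain R]

theorem Ideal.mem_associatedPrimes_quotient_ofList (hzs : IsWeaklyRegular R zs) {p : Ideal R}
    [p.IsPrime] (hzp : ∀ z ∈ zs, z ∈ p) (hp : p.height = zs.length) :
    p ∈ associatedPrimes R (R ⧸ Ideal.ofList zs) := by
  apply Module.associatedPrimes.minimalPrimes_annihilator_subset_associatedPrimes
  rw [Ideal.annihilator_quotient]
  refine ⟨⟨‹_›, Ideal.span_le.2 hzp⟩, fun q ⟨hq, hzq⟩ hqp ↦ ?_⟩
  by_contra h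
  have h1 := Ideal.height_add_one_le_of_lt_of_isPrime (lt_of_le_not_ge hqp h)
  have h2 := IsRegularSystem.length_le_height hzs (p := q) fun r hr ↦ hzq (Ideal.subset_span hr)
  rw [hp] at h1
  have h3 := (add_le_add_left h2 1).trans h1
  norm_cast at h3
  omega

/-- Double linkage: an unmixed ideal `I` is recovered from its link. -/
theorem Ideal.colon_colon_ofList_le (hx : IsRegularSystem xs) (hzs : IsWeaklyRegular R zs)
    (hzI : ∀ z ∈ zs, z ∈ I)
    (hI : ∀ p ∈ associatedPrimes R (R ⧸ I), p.height = zs.length) :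
    (Ideal.ofList zs).colon ((Ideal.ofList zs).colon (I : Set R) : Set R) ≤ I := by
  intro y₀ hy₀
  by_contra hy₀I
  let N := Submodule.map I.mkQ
    ((Ideal.ofList zs).colon ((Ideal.ofList zs).colon (I : Set R) : Set R))
  have : Nontrivial N := ⟨⟨⟨I.mkQ y₀, y₀, hy₀, rfl⟩, 0, fun h ↦
    hy₀I ((Submodule.Quotient.mk_eq_zero I).1 (congrArg Subtype.val h))⟩⟩
  obtain ⟨p, hpN⟩ := associatedPrimes.nonempty R N
  have hpI := associatedPrimes.subset_of_injective N.subtype_injective hpN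
  obtain ⟨hp, ⟨_, y, hy, rfl⟩, hpy⟩ := isAssociatedPrime_iff.mp hpN
  have hpmem : ∀ t, t ∈ p ↔ t * y ∈ I := fun t ↦ by
    rw [hpy, Submodule.mem_colon_singleton, Submodule.mem_bot, ← Submodule.Quotient.mk_eq_zero I]
    exact Subtype.ext_iff
  have hIp : I ≤ p := fun t ht ↦ (hpmem t).2 (I.mul_mem_right _ ht)
  obtain ⟨-, a, ha⟩ := isAssociatedPrime_iff.mp
    (Ideal.mem_associatedPrimes_quotient_ofList hzs (fun z hz ↦ hIp (hzI z hz)) (hI p hpI))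
  have hpa : ∀ t, t ∈ p ↔ t • a = 0 := fun t ↦ by
    rw [ha, Submodule.mem_colon_singleton, Submodule.mem_bot]
  obtain ⟨f, g, hfr, hf, hfg, hg⟩ := exists_shortExact_colon I p y hpmem
  have hzX : ∀ z ∈ zs, ∀ m : R ⧸ I, z • m = 0 := fun z hz m ↦ by
    obtain ⟨m, rfl⟩ := Ideal.Quotient.mk_surjective m
    exact Ideal.Quotient.eq_zero_iff_mem.2 (I.mul_mem_right m (hzI z hz))
  obtain ⟨ψ, hψ, -⟩ := exists_hom_to_ext hf hfg hg zs hzs hzX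
  let φ : (R ⧸ p) →ₗ[R] R ⧸ Ideal.ofList zs :=
    Submodule.liftQ p (LinearMap.toSpanSingleton R _ a) fun t ht ↦ (hpa t).1 ht
  obtain ⟨s, hs, hext⟩ := hx.extVanishesAt p (I ⊔ Ideal.span {y}) (j := zs.length + 1) (by
    rw [hI p hpI]
    exact_mod_cast Nat.lt_succ_self _)
  obtain ⟨φ', hφ'⟩ := (hψ (s • φ)).1 (by rw [map_smul, hext])
  refine hs ((hpa s).2 ?_)
  have h1 : φ' (Ideal.Quotient.mk I y) = s • a := by
    have := LinearMap.congr_fun hφ' (Ideal.Quotient.mk p 1)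
    rw [LinearMap.comp_apply, hfr, one_mul] at this
    rw [this, LinearMap.smul_apply]
    congr 1
    exact one_smul R a
  have h2 : ∀ r, φ' (Ideal.Quotient.mk I r) = r • φ' (Ideal.Quotient.mk I 1) := fun r ↦ by
    rw [← map_smul]
    change _ = φ' (Ideal.Quotient.mk I (r • 1))
    rw [smul_eq_mul, mul_one]
  obtain ⟨ω, hω⟩ := Ideal.Quotient.mk_surjective (φ' (Ideal.Quotient.mk I 1))
  have hωL : ω ∈ (Ideal.ofList zs).colon (I : Set R) := Submodule.mem_colon.2 fun i hi ↦ by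
    have := h2 i
    rw [Ideal.Quotient.eq_zero_iff_mem.2 hi, map_zero, ← hω] at this
    rw [smul_eq_mul, mul_comm]
    exact Ideal.Quotient.eq_zero_iff_mem.1 this.symm
  rw [← h1, h2, ← hω]
  exact Ideal.Quotient.eq_zero_iff_mem.2 (Submodule.mem_colon.1 hy ω hωL)

end Linkage

section Linkage

variable {R : Type u} [CommRing R] {I : Ideal R} {xs zs : List R}

theorem Ideal.exists_isSMulRegular_quotient_colon [IsNoetherianRing R] [IsLocalRing R]
    (hx : IsRegularSystem xs) (hzs : IsWeaklyRegular R zs) {p : Ideal R}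
    (hp : (zs.length : ℕ∞) < p.height) :
    ∃ x ∈ p, ∀ r, x * r ∈ (Ideal.ofList zs).colon (I : Set R) →
      r ∈ (Ideal.ofList zs).colon (I : Set R) := by
  by_contra! hcon
  let L := (Ideal.ofList zs).colon (I : Set R)
  obtain ⟨q, hq, hpq⟩ := (Ideal.subset_union_prime_finite (associatedPrimes.finite R (R ⧸ L))
    (f := id) ⊥ ⊥ (fun i hi _ _ ↦ IsAssociatedPrime.isPrime hi) (I := p)).mp (by
      intro x hxp
      simp_rw [id, biUnion_associatedPrimes_eq_zero_divisors]
      obtain ⟨r, hxr, hr⟩ := hcon x hxp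
      exact ⟨Ideal.Quotient.mk L r, fun h ↦ hr (Ideal.Quotient.eq_zero_iff_mem.1 h),
        Ideal.Quotient.eq_zero_iff_mem.2 hxr⟩)
  obtain ⟨hqp, m, hm⟩ := isAssociatedPrime_iff.mp hq
  obtain ⟨r, rfl⟩ := Ideal.Quotient.mk_surjective m
  have hmem : ∀ t, t ∈ q ↔ t * r ∈ L := fun t ↦ by
    rw [hm, Submodule.mem_colon_singleton, Submodule.mem_bot, ← Ideal.Quotient.eq_zero_iff_mem]
    rfl
  have hr : r ∉ L := fun h ↦ hqp.ne_top ((Ideal.eq_top_iff_one q).2 ((hmem 1).2 (by simpa)))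
  obtain ⟨i, hi, hri⟩ : ∃ i ∈ (I : Set R), r • i ∉ Ideal.ofList zs := by
    by_contra! h
    exact hr (Submodule.mem_colon.2 h)
  refine ((hp.trans_le (Ideal.height_mono hpq)).trans_le
    (hx.height_le_length_of_smul_eq_zero hzs (m := Ideal.Quotient.mk _ (r • i))
      (fun h ↦ hri (Ideal.Quotient.eq_zero_iff_mem.1 h)) fun t ht ↦ ?_)).false
  have := Submodule.mem_colon.1 ((hmem t).1 ht) i hi
  rw [smul_eq_mul, mul_assoc] at this
  exact Ideal.Quotient.eq_zero_iff_mem.2 this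

/-- `Ext^d(R / ((z) : I), R)` is `I / (z)` when `I` is its own double link. -/
theorem nonempty_ext_quotient_colon_linearEquiv (hzs : IsWeaklyRegular R zs)
    (hII : (Ideal.ofList zs).colon ((Ideal.ofList zs).colon (I : Set R) : Set R) ≤ I) :
    Nonempty (ModuleExt R (R ⧸ (Ideal.ofList zs).colon (I : Set R)) R zs.length ≃ₗ[R]
      ↥I ⧸ Submodule.comap I.subtype (Ideal.ofList zs)) := by
  let J := Ideal.ofList zs
  let L := J.colon (I : Set R)
  have hJL : J ≤ L := fun j hj ↦ Submodule.mem_colon.2 fun i _ ↦ J.mul_mem_right i hj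
  obtain ⟨α, hα⟩ := exists_linearEquiv_ext zs hzs
  obtain ⟨e, -⟩ := hα (R ⧸ L) fun z hz m ↦ by
    obtain ⟨m, rfl⟩ := Ideal.Quotient.mk_surjective m
    exact Ideal.Quotient.eq_zero_iff_mem.2 (L.mul_mem_right m (hJL (Ideal.subset_span hz)))
  let θ : I →ₗ[R] (R ⧸ L) →ₗ[R] R ⧸ J :=
    { toFun i := Submodule.liftQ L (i.1 • J.mkQ) fun l hl ↦ by
        have := Submodule.mem_colon.1 hl i i.2
        rw [smul_eq_mul, mul_comm] at this
        exact Ideal.Quotient.eq_zero_iff_mem.2 this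
      map_add' i i' := LinearMap.ext fun m ↦ by
        obtain ⟨m, rfl⟩ := Submodule.Quotient.mk_surjective _ m
        exact add_smul i.1 i'.1 (J.mkQ m)
      map_smul' r i := LinearMap.ext fun m ↦ by
        obtain ⟨m, rfl⟩ := Submodule.Quotient.mk_surjective _ m
        exact mul_smul r i.1 (J.mkQ m) }
  have hθ : ∀ (i : I) (r : R), θ i (Submodule.Quotient.mk r) = Submodule.Quotient.mk (i.1 * r) :=
    fun i r ↦ rfl
  have hθs : Function.Surjective θ := fun φ ↦ by
    obtain ⟨r, hr⟩ := Submodule.Quotient.mk_surjective _ (φ (Submodule.Quotient.mk 1))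
    have hφ : ∀ l, φ (Submodule.Quotient.mk l) = Submodule.Quotient.mk (r * l) := fun l ↦ by
      rw [mul_comm, ← smul_eq_mul, Submodule.Quotient.mk_smul, hr, ← map_smul,
        ← Submodule.Quotient.mk_smul, smul_eq_mul, mul_one]
    refine ⟨⟨r, hII (Submodule.mem_colon.2 fun l hl ↦ ?_)⟩, ?_⟩
    · rw [smul_eq_mul, ← Submodule.Quotient.mk_eq_zero, ← hφ,
        (Submodule.Quotient.mk_eq_zero L).2 hl, map_zero]
    · refine LinearMap.ext fun m ↦ ?_
      obtain ⟨m, rfl⟩ := Submodule.Quotient.mk_surjective _ m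
      rw [hθ, hφ]
  have hker : Submodule.comap I.subtype J = LinearMap.ker θ := by
    ext i
    rw [LinearMap.mem_ker, Submodule.mem_comap]
    refine ⟨fun hi ↦ LinearMap.ext fun m ↦ ?_, fun hi ↦ ?_⟩
    · obtain ⟨m, rfl⟩ := Submodule.Quotient.mk_surjective _ m
      rw [hθ]
      exact Ideal.Quotient.eq_zero_iff_mem.2 (J.mul_mem_right m hi)
    · have := LinearMap.congr_fun hi (Submodule.Quotient.mk 1)
      rw [hθ, mul_one] at this
      exact Ideal.Quotient.eq_zero_iff_mem.1 this
  exact ⟨e.symm ≪≫ₗ ((Submodule.quotEquivOfEq _ _ hker).trans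
    (θ.quotKerEquivOfSurjective hθs)).symm⟩

variable [IsNoetherianRing R] [IsLocalRing R] [IsDomain R]

/-- The vanishing of `Ext^{d + 1}(R / ((z) : I), R)` when `R / I` satisfies `S_2`. -/
theorem subsingleton_ext_quotient_colon (hx : IsRegularSystem xs) (hzs : IsWeaklyRegular R zs)
    (hS : SerreS (R ⧸ I) 2)
    (hI : ∀ p ∈ I.minimalPrimes, p.height = zs.length)
    (hII : (Ideal.ofList zs).colon ((Ideal.ofList zs).colon (I : Set R) : Set R) ≤ I) :
    Subsingleton (ModuleExt R (R ⧸ (Ideal.ofList zs).colon (I : Set R)) R (zs.length + 1)) := by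
  let J := Ideal.ofList zs
  let L := J.colon (I : Set R)
  have hJL : J ≤ L := fun j hj ↦ Submodule.mem_colon.2 fun i _ ↦ J.mul_mem_right i hj
  by_contra hsub
  rw [not_subsingleton_iff_nontrivial] at hsub
  obtain ⟨p, hpC⟩ := associatedPrimes.nonempty R (ModuleExt R (R ⧸ L) R (zs.length + 1))
  have hp : p.IsPrime := hpC.isPrime
  have hvan : ¬ ExtVanishesAt p (R ⧸ L) (zs.length + 1) := fun ⟨s, hs, h⟩ ↦
    hs (le_of_mem_associatedPrimes_of_forall_smul_eq_zero hpC h)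
  have hpd : ((zs.length + 1 : ℕ) : ℕ∞) ≤ p.height := by
    by_contra! h
    exact hvan (hx.extVanishesAt p L h)
  have hpd' : (zs.length : ℕ∞) < p.height :=
    lt_of_lt_of_le (by exact_mod_cast Nat.lt_succ_self _) hpd
  have hpd₂ : ((zs.length + 2 : ℕ) : ℕ∞) ≤ p.height := by
    by_contra! h
    obtain ⟨x, hxp, hxreg⟩ := Ideal.exists_isSMulRegular_quotient_colon (I := I) hx hzs hpd'
    obtain ⟨f, g, hfr, hf, hfg, hg⟩ := exists_shortExact_colon L L x fun r ↦
      ⟨fun hr ↦ L.mul_mem_right _ hr, fun hr ↦ hxreg r (by rwa [mul_comm])⟩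
    refine hvan (.of_exact_smul hxp (fun m ↦ ?_) hf hfg hg (hx.extVanishesAt p _ h))
    obtain ⟨r, rfl⟩ := Ideal.Quotient.mk_surjective m
    rw [hfr, mul_comm]
    rfl
  let g : (R ⧸ J) →ₗ[R] R ⧸ L := Submodule.factor hJL
  let Ω := LinearMap.ker g
  have hΩ : ∀ r, Submodule.Quotient.mk r ∈ Ω ↔ r ∈ L := fun r ↦ by
    rw [← Submodule.Quotient.mk_eq_zero L]
    rfl
  have hJ : ∀ t ∈ J, ∀ m : R ⧸ J, t • m = 0 := fun t ht m ↦ by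
    obtain ⟨m, rfl⟩ := Ideal.Quotient.mk_surjective m
    exact Ideal.Quotient.eq_zero_iff_mem.2 (J.mul_mem_right m ht)
  obtain ⟨ψ, hψ, hψs⟩ := exists_hom_to_ext (f := Ω.subtype) (g := g) Ω.subtype_injective
    (LinearMap.exact_subtype_ker_map g) (Submodule.factor_surjective hJL) zs hzs
    fun z hz ↦ hJ z (Ideal.subset_span hz)
  replace hψs := hψs (subsingleton_ext_quotient_ofList R hzs (Nat.lt_succ_self _))
  have hIΩ : ∀ i ∈ I, ∀ ω : Ω, i • ω = 0 := by
    rintro i hi ⟨ω, hω⟩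
    obtain ⟨r, rfl⟩ := Submodule.Quotient.mk_surjective _ ω
    have := Submodule.mem_colon.1 ((hΩ r).1 hω) i hi
    rw [smul_eq_mul, mul_comm] at this
    exact Subtype.ext (Ideal.Quotient.eq_zero_iff_mem.2 this)
  have hIp : I ≤ p := fun i hi ↦ le_of_mem_associatedPrimes_of_forall_smul_eq_zero hpC fun c ↦ by
    obtain ⟨φ, rfl⟩ := hψs c
    rw [← map_smul, show i • φ = 0 from LinearMap.ext fun ω ↦ by
      rw [LinearMap.smul_apply, ← map_smul, hIΩ i hi, map_zero, LinearMap.zero_apply], map_zero]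
  obtain ⟨q, hq, hqp⟩ := Ideal.exists_minimalPrimes_le hIp
  have hqprime := hq.1.1
  obtain ⟨q₁, hq₁, hqq₁, hq₁p⟩ := hx.exists_isPrime_between hqp (by
    rw [hI q hq]; exact_mod_cast hpd₂)
  obtain ⟨a, ha, b, hb, hreg, hreg'⟩ := hS.exists_of_lt_of_lt hq.1.2 hqq₁ hq₁p
  refine notMem_associatedPrimes_of_exact ha hb hreg hreg'
    (LinearMap.toSpanSingleton R (Ω →ₗ[R] R ⧸ J) Ω.subtype) (fun r ↦ ⟨fun h ↦ hII ?_, fun h ↦ ?_⟩)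
    ψ (fun φ ↦ ?_) hψs ?_ hpC
  · refine Submodule.mem_colon.2 fun l hl ↦ ?_
    have := LinearMap.congr_fun h ⟨Submodule.Quotient.mk l, (hΩ l).2 hl⟩
    exact Ideal.Quotient.eq_zero_iff_mem.1 this
  · ext ω
    exact congrArg Subtype.val (hIΩ r h ω)
  · rw [hψ]
    constructor
    · rintro ⟨φ', rfl⟩
      obtain ⟨r, hr⟩ := Submodule.Quotient.mk_surjective _ (φ' (Submodule.Quotient.mk 1))
      refine ⟨r, LinearMap.ext fun ω ↦ ?_⟩
      obtain ⟨ω, hω⟩ := ω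
      obtain ⟨s, rfl⟩ := Submodule.Quotient.mk_surjective _ ω
      change r • (Submodule.Quotient.mk s : R ⧸ J) = φ' (Submodule.Quotient.mk s)
      rw [← mul_one s, ← smul_eq_mul, Submodule.Quotient.mk_smul, map_smul, ← hr, smul_comm,
        ← Submodule.Quotient.mk_smul _ r, smul_eq_mul, mul_one]
    · rintro ⟨r, rfl⟩
      exact ⟨r • LinearMap.id, rfl⟩
  · intro h
    obtain ⟨-, φ, hφ⟩ := isAssociatedPrime_iff.mp h
    have hpφ : ∀ t, t ∈ p ↔ t • φ = 0 := fun t ↦ by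
      rw [hφ, Submodule.mem_colon_singleton, Submodule.mem_bot]
    obtain ⟨ω, hω⟩ : ∃ ω, φ ω ≠ 0 := by
      by_contra! h0
      exact hp.ne_top ((Ideal.eq_top_iff_one p).2 ((hpφ 1).2 (LinearMap.ext fun ω ↦ by simp [h0])))
    refine (hpd'.trans_le (hx.height_le_length_of_smul_eq_zero hzs hω fun t ht ↦ ?_)).false
    rw [← LinearMap.smul_apply, (hpφ t).1 ht, LinearMap.zero_apply]

end Linkage

end

/-- Let `(R,m,k)` be a regular local ring, let `I` be an ideal
of height `d` such that `R/I` satisfies Serre's condition `S_2`, and let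
`z₁,…,z_d ∈ I` be an `R`-regular sequence.  Set `Ω̃ = ((z₁,…,z_d) :_R I)`.
Then `Ext^d_R(R/Ω̃, R) ≅ I/(z₁,…,z_d)` and `Ext^{d+1}_R(R/Ω̃, R) = 0`. -/
theorem statement9
    (R : Type u) [CommRing R] [IsLocalRing R] (hreg : IsRegularLocal R)
    (I : Ideal R) (d : ℕ) (hht : HeightEq R I d)
    (hS2 : SerreS (R ⧸ I) 2)
    (z : Fin d → R) (hzI : ∀ j, z j ∈ I)
    (hzreg : RingTheory.Sequence.IsRegular R (List.ofFn z)) :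
    Nonempty
      ((ExtMod R d (R ⧸ (Ideal.span (Set.range z)).colon I) R) ≃ₗ[R]
        (↥I ⧸ Submodule.comap I.subtype (Ideal.span (Set.range z)))) ∧
    Subsingleton (ExtMod R (d + 1) (R ⧸ (Ideal.span (Set.range z)).colon I) R) := by
  obtain ⟨hN, n, x, hx, hdim⟩ := hreg
  obtain ⟨hdom, xs, hlen, hxs, hxm⟩ := isDomain_and_exists_isWeaklyRegular n R x hx hdim
  have hsys : IsRegularSystem xs := ⟨hxs, hxm, by
    rw [hlen]
    exact WithBot.coe_injective (maximalIdeal_height_eq_ringKrullDim.trans hdim)⟩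
  have hzs := hzreg.toIsWeaklyRegular
  have hmem : ∀ r ∈ List.ofFn z, r ∈ I := by simpa [List.mem_ofFn] using hzI
  have hspan : Ideal.ofList (List.ofFn z) = Ideal.span (Set.range z) :=
    congrArg Ideal.span (Set.ext fun _ ↦ List.mem_ofFn)
  have hheight (p : Ideal R) (hp : p ∈ I.minimalPrimes) : p.height = (List.ofFn z).length := by
    rw [List.length_ofFn]
    refine Ideal.height_eq_of_mem_minimalPrimes_of_serreS hsys hS2 ?_ (fun P hP hIP ↦ ?_) hp
    · obtain ⟨P, hP, hIP, hPd⟩ := hht.1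
      rw [IsLocalization.AtPrime.ringKrullDim_eq_height P] at hPd
      exact ⟨P, hP, hIP, WithBot.coe_injective hPd⟩
    · have h := hht.2 P hP hIP
      rw [IsLocalization.AtPrime.ringKrullDim_eq_height P] at h
      exact WithBot.coe_le_coe.1 h
  have hII := Ideal.colon_colon_ofList_le hsys hzs hmem fun p hp ↦
    hheight p (Ideal.mem_minimalPrimes_of_mem_associatedPrimes_of_serreS hS2 hp)
  have hsub := subsingleton_ext_quotient_colon hsys hzs hS2 hheight hII
  obtain ⟨e⟩ := nonempty_ext_quotient_colon_linearEquiv hzs hII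
  obtain ⟨f⟩ := nonempty_linearEquiv_moduleExt (R := R)
    (R ⧸ (Ideal.ofList (List.ofFn z)).colon (I : Set R)) R (List.ofFn z).length
  obtain ⟨g⟩ := nonempty_linearEquiv_moduleExt (R := R)
    (R ⧸ (Ideal.ofList (List.ofFn z)).colon (I : Set R)) R ((List.ofFn z).length + 1)
  have hequiv := Nonempty.intro (f.trans e)
  have hvan := g.toEquiv.subsingleton
  rw [List.length_ofFn, hspan] at hequiv hvan
  exact ⟨hequiv, hvan⟩
end

section
/- Let R be a Noetherian local ring, P a prime ideal of height d, and x_1,…,x_d ∈ P an R-regular sequence with PR_P = (x_1,…,x_d)R_P. Let (x_1,…,x_d) = P ∩ q_2 ∩ ⋯ ∩ q_r be a primary decomposition with q_i a P_i-primary ideal for 2 ≤ i ≤ r, and let λ ∈ P with λ ∉ P_i for all 2 ≤ i ≤ r. Then for every integer t ≥ 1: (i) ((x_1,…,x_d) :_R λ^t) = q_2 ∩ ⋯ ∩ q_r, so that (x_1,…,x_d) ∩ λ^t R = λ^t (q_2 ∩ ⋯ ∩ q_r); and (ii) Hom_R(R/((x_1,…,x_d) + λ^t R), R/(x_1,…,x_d))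 = Hom_R(R/P, R/(x_1,…,x_d)) = (q_2 ∩ ⋯ ∩ q_r)/(x_1,…,x_d) as submodules of R/(x_1,…,x_d). -/
open IsLocalRing

universe u

variable (R : Type u) [CommRing R]

/-- Let `R` be a Noetherian local ring, `P` a prime ideal of
height `d`, and `x₁,…,x_d ∈ P` an `R`-regular sequence with
`P·R_P = (x₁,…,x_d)·R_P`.  Let `(x₁,…,x_d) = P ∩ q₂ ∩ ⋯ ∩ q_r` be a primary
decomposition with `q_i` a `P_i`-primary ideal for `2 ≤ i ≤ r`, and let
`λ ∈ P` with `λ ∉ P_i` for all `2 ≤ i ≤ r`.  Then for every integer `t ≥ 1`: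
(i) `((x₁,…,x_d) :_R λ^t) = q₂ ∩ ⋯ ∩ q_r`, so that
`(x₁,…,x_d) ∩ λ^t R = λ^t (q₂ ∩ ⋯ ∩ q_r)`; and
(ii) `Hom_R(R/((x₁,…,x_d) + λ^t R), R/(x₁,…,x_d)) = Hom_R(R/P, R/(x₁,…,x_d))
= (q₂ ∩ ⋯ ∩ q_r)/(x₁,…,x_d)` as submodules of `R/(x₁,…,x_d)` — via the
identification `Hom_R(R/b, R/a) = (a :_R b)/a`, this says that the colon ideals
`((x) :_R (x) + λ^t R)` and `((x) :_R P)` both equal `q₂ ∩ ⋯ ∩ q_r`. -/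
theorem statement13
    (R : Type u) [CommRing R] [IsLocalRing R] [IsNoetherianRing R]
    (P : Ideal R) (hP : P.IsPrime) (d : ℕ) (hht : HeightEq R P d)
    (x : Fin d → R) (hxP : ∀ j, x j ∈ P)
    (hxreg : RingTheory.Sequence.IsRegular R (List.ofFn x))
    (hloc : Ideal.map (algebraMap R (@Localization.AtPrime R _ P hP)) P =
      Ideal.map (algebraMap R (@Localization.AtPrime R _ P hP))
        (Ideal.span (Set.range x)))
    {r : ℕ} (q : Fin r → Ideal R) (Pi : Fin r → Ideal R)
    (hprimary : ∀ i, (q i).IsPrimary ∧ (q i).radical = Pi i)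
    (hdecomp : Ideal.span (Set.range x) = P ⊓ ⨅ i, q i)
    (lam : R) (hlamP : lam ∈ P) (hlam : ∀ i, lam ∉ Pi i)
    (t : ℕ) (ht : 1 ≤ t) :
    -- (i)
    ((Ideal.span (Set.range x)).colon (Ideal.span {lam ^ t}) = ⨅ i, q i ∧
      Ideal.span (Set.range x) ⊓ Ideal.span {lam ^ t} =
        Ideal.span {lam ^ t} * ⨅ i, q i) ∧
    -- (ii)
    ((Ideal.span (Set.range x)).colon
        (Ideal.span (Set.range x) ⊔ Ideal.span {lam ^ t}) = ⨅ i, q i ∧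
      (Ideal.span (Set.range x)).colon P = ⨅ i, q i) := by
  have hcolon : ∀ S : Set R, S ⊆ P → lam ^ t ∈ S →
      (Ideal.span (Set.range x)).colon S = ⨅ i, q i := by
    intro S hSP hS
    ext y
    rw [Submodule.mem_colon]
    constructor
    · intro h
      have hy : y * lam ^ t ∈ ⨅ i, q i := (hdecomp.le (h _ hS)).2
      rw [Ideal.mem_iInf] at hy ⊢
      intro i
      refine ((Ideal.isPrimary_iff.1 (hprimary i).1).2 (hy i)).resolve_right fun hrad ↦ ?_
      exact hlam i ((hprimary i).2 ▸ (Ideal.isPrime_radical (hprimary i).1).mem_of_pow_mem t hrad)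
    · intro h p hp
      rw [hdecomp]
      exact ⟨P.mul_mem_left y (hSP hp), Ideal.mul_mem_right p _ h⟩
  have hle : Ideal.span (Set.range x) ≤ P := hdecomp ▸ inf_le_left
  have hlamt : lam ^ t ∈ P := P.pow_mem_of_mem hlamP t ht
  have hspan : Ideal.span {lam ^ t} ≤ P := (Ideal.span_singleton_le_iff_mem P).2 hlamt
  have hmem : lam ^ t ∈ Ideal.span {lam ^ t} := Ideal.mem_span_singleton_self _
  have hone := hcolon _ hspan hmem
  refine ⟨⟨hone, le_antisymm ?_ ?_⟩, hcolon _ (sup_le hle hspan) (Or.inr hmem),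
    hcolon _ subset_rfl hlamt⟩
  · rintro z ⟨hz, hzt⟩
    obtain ⟨y, rfl⟩ := Ideal.mem_span_singleton'.1 hzt
    rw [mul_comm y]
    refine Ideal.mul_mem_mul hmem ?_
    rw [← hone, Submodule.mem_colon]
    intro p hp
    obtain ⟨a, rfl⟩ := Ideal.mem_span_singleton'.1 hp
    rw [smul_eq_mul, mul_left_comm]
    exact Ideal.mul_mem_left _ a hz
  · refine le_inf ?_ Ideal.mul_le_left
    rw [hdecomp]
    exact le_inf (Ideal.mul_le_left.trans hspan) Ideal.mul_le_right
end
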